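/- arXiv:1504.04886 — 5 statements merged into one kernel-verified Lean document; each statement's English description precedes it below -/
import Mathlib

section
/- Let A be a deformation quantization of A₁ over W_n(k) with n ≥ 1 and structural isomorphism ψ : A/pA ≅ A₁. Then the image of the center of A under the composite A → A/pA ≅ A₁ equals S^{p^{n−1}} = { s^{p^{n−1}} : s ∈ S } ⊆ S = Z(A₁). -/
universe u

open scoped TensorProduct

/-- A symplectic Poisson structure on a commutative `k`-algebra `S`: a `k`-bilinear,
antisymmetric bracket which is a derivation in each argument, satisfies the Jacobi identity,
and is nondegenerate in the sense that the `S`-linear map `ι : Ω¹_{S/k} → Der_k(S,S)`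
determined by `ι(g·df) = g·{f,·}` is bijective. -/
structure SymplecticPoisson (k S : Type u) [CommRing k] [CommRing S] [Algebra k S] where
  bracket : S → S → S
  add_left : ∀ x y z : S, bracket (x + y) z = bracket x z + bracket y z
  smul_left : ∀ (c : k) (x z : S), bracket (c • x) z = c • bracket x z
  antisymm : ∀ x y : S, bracket x y = - bracket y x
  leibniz : ∀ x y z : S, bracket x (y * z) = bracket x y * z + y * bracket x z
  jacobi : ∀ x y z : S,
    bracket x (bracket y z) + bracket y (bracket z x) + bracket z (bracket x y) = 0
  nondeg : ∃ ι : KaehlerDifferential k S ≃ₗ[S] Derivation k S S,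
    ∀ f g x : S, ι (g • KaehlerDifferential.D k S f) x = g * bracket f x

/-- The natural map `A ⊗[S] Aᵐᵒᵖ → End_S(A)`, `a ⊗ b ↦ (x ↦ a·x·b)`. -/
noncomputable def mulLeftRightMap (S : Type u) (A : Type*) [CommRing S] [Ring A]
    [Algebra S A] : A ⊗[S] Aᵐᵒᵖ →ₗ[S] Module.End S A :=
  TensorProduct.lift <| LinearMap.mk₂ S
    (fun a b => (LinearMap.mulRight S b.unop) ∘ₗ (LinearMap.mulLeft S a))
    (fun a₁ a₂ b => by ext x; simp [add_mul])
    (fun s a b => by ext x; simp [smul_mul_assoc])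
    (fun a b₁ b₂ => by ext x; simp [mul_add])
    (fun s a b => by ext x; simp [mul_smul_comm])

/-- `A` is an Azumaya algebra over `S`: a finitely generated faithful projective `S`-module
such that the natural map `A ⊗[S] Aᵐᵒᵖ → End_S(A)` is bijective. -/
def IsAzumayaOver (S : Type u) (A : Type*) [CommRing S] [Ring A] [Algebra S A] : Prop :=
  Module.Finite S A ∧ Module.Projective S A ∧ FaithfulSMul S A ∧
    Function.Bijective (mulLeftRightMap S A)

open Polynomial in
theorem Polynomial.coeff_pow_mul_derivative {R : Type*} [CommRing R] (f : R[X]) {p : ℕ}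
    (hp : p ≠ 0) :
    (f ^ (p - 1) * derivative f).coeff (p - 1) = (f ^ p).coeff p := by
  obtain ⟨q, rfl⟩ := Nat.exists_eq_succ_of_ne_zero hp
  simp only [Nat.succ_eq_add_one, Nat.add_sub_cancel]
  have lift_case (g : (MvPolynomial R ℤ)[X]) :
      (g ^ q * derivative g).coeff q = (g ^ (q + 1)).coeff (q + 1) := by
    have h := congrArg (fun f => coeff f q) (derivative_pow_succ g q)
    simp only [coeff_derivative, mul_assoc, coeff_C_mul] at h
    have hq : ((q : MvPolynomial R ℤ) + 1) ≠ 0 := by exact_mod_cast Nat.succ_ne_zero q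
    exact mul_left_cancel₀ hq (h.symm.trans (mul_comm _ _))
  obtain ⟨g, rfl⟩ := Polynomial.map_surjective
    ((MvPolynomial.aeval (R := ℤ) (id : R → R)).toRingHom)
    (fun r => ⟨MvPolynomial.X r, by simp⟩) f
  rw [derivative_map, ← Polynomial.map_pow, ← Polynomial.map_mul, ← Polynomial.map_pow, coeff_map,
    coeff_map, lift_case]

open Polynomial in
theorem Polynomial.coeff_char_pow_char {R : Type*} [CommRing R] (p : ℕ) [Fact p.Prime] [CharP R p]
    (f : R[X]) : (f ^ p).coeff p = f.coeff 1 ^ p := by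
  rw [← map_frobenius_expand p f, coeff_map]
  have h := coeff_expand_mul (p := p) (Fact.out : p.Prime).pos f 1
  rw [one_mul] at h
  rw [h, frobenius_def]

open Finset in
theorem Derivation.iterate_mul {k S : Type*} [CommRing k] [CommRing S] [Algebra k S]
    (D : Derivation k S S) (n : ℕ) (x y : S) :
    D^[n] (x * y) =
      ∑ ij ∈ antidiagonal n, n.choose ij.1 • (D^[ij.1] x * D^[ij.2] y) := by
  induction n with
  | zero => simp
  | succ n ih =>
    rw [Finset.sum_antidiagonal_choose_succ_nsmul (fun i j => D^[i] x * D^[j] y),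
      Function.iterate_succ_apply', ih, map_sum, ← Finset.sum_add_distrib]
    refine Finset.sum_congr rfl fun ij hij => ?_
    rw [D.map_smul_of_tower, D.leibniz, Function.iterate_succ_apply', Function.iterate_succ_apply',
      Nat.choose_symm_of_eq_add (mem_antidiagonal.mp hij).symm]
    simp only [smul_eq_mul, smul_add]
    ring

section Hochschild

variable {k S : Type*} [Field k] [CommRing S] [Algebra k S] (p : ℕ) [Fact p.Prime]

omit [Fact p.Prime] in
theorem Derivation.map_pow_char [CharP S p] (D : Derivation k S S) (x : S) : D (x ^ p) = 0 := by
  simp [D.leibniz_pow, ← Nat.cast_smul_eq_nsmul S]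

omit [Fact p.Prime] in
theorem Derivation.map_pow_char_mul [CharP S p] (D : Derivation k S S) (x y : S) :
    D (x ^ p * y) = x ^ p * D y := by
  simp [D.leibniz, D.map_pow_char p]

omit [Fact p.Prime] in
theorem Derivation.iterate_pow_char_mul [CharP S p] (D : Derivation k S S) (x y : S) (n : ℕ) :
    D^[n] (x ^ p * y) = x ^ p * D^[n] y := by
  induction n with
  | zero => rfl
  | succ n ih => rw [Function.iterate_succ_apply', ih, D.map_pow_char_mul p,
      Function.iterate_succ_apply']

/-- In characteristic `p`, the `p`-th iterate of a derivation is a derivation. -/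
noncomputable def Derivation.iterateChar [CharP S p] (D : Derivation k S S) : Derivation k S S :=
  Derivation.mk' ((D : S →ₗ[k] S) ^ p) fun x y => by
    have hD (n : ℕ) (z : S) : ((D : S →ₗ[k] S) ^ n) z = D^[n] z := by
      rw [Module.End.pow_apply]; rfl
    have hp := (Fact.out : p.Prime)
    simp only [hD, D.iterate_mul, smul_eq_mul]
    rw [Finset.Nat.sum_antidiagonal_eq_sum_range_succ
      (fun i j => p.choose i • (D^[i] x * D^[j] y)), Finset.sum_range_succ]
    obtain ⟨q, hq⟩ := Nat.exists_eq_succ_of_ne_zero hp.ne_zero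
    rw [show Finset.range p = Finset.range (q + 1) by rw [hq], Finset.sum_range_succ',
      Finset.sum_eq_zero]
    · simp; ring
    · intro i hi
      rw [Finset.mem_range] at hi
      rw [← Nat.cast_smul_eq_nsmul S, (CharP.cast_eq_zero_iff S p _).mpr
        (hp.dvd_choose_self (Nat.succ_ne_zero i) (by omega)), zero_smul]

theorem Derivation.iterateChar_apply [CharP S p] (D : Derivation k S S) (x : S) :
    D.iterateChar p x = D^[p] x := by
  change ((D : S →ₗ[k] S) ^ p) x = _
  rw [Module.End.pow_apply]; rfl

open Polynomial

/-- The exponential of a derivation, truncated in degree `p`. -/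
noncomputable def Derivation.truncatedExp (D : Derivation k S S) (x : S) : S[X] :=
  ∑ i ∈ Finset.range p, monomial i ((i.factorial : k)⁻¹ • D^[i] x)

omit [Fact p.Prime] in
theorem Derivation.coeff_truncatedExp (D : Derivation k S S) (x : S) (n : ℕ) :
    (D.truncatedExp p x).coeff n = if n < p then (n.factorial : k)⁻¹ • D^[n] x else 0 := by
  simp [truncatedExp, coeff_monomial]

theorem Polynomial.coeff_mul_congr {f f' g g' : S[X]} {p : ℕ}
    (hf : ∀ n < p, f.coeff n = f'.coeff n) (hg : ∀ n < p, g.coeff n = g'.coeff n) :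
    ∀ n < p, (f * g).coeff n = (f' * g').coeff n := by
  intro n hn
  rw [coeff_mul, coeff_mul]
  refine Finset.sum_congr rfl fun ij hij => ?_
  rw [Finset.HasAntidiagonal.mem_antidiagonal] at hij
  rw [hf _ (by omega), hg _ (by omega)]

theorem Nat.factorial_cast_ne_zero_of_lt [CharP k p] {n : ℕ} (hn : n < p) :
    (n.factorial : k) ≠ 0 := by
  rw [Ne, CharP.cast_eq_zero_iff k p, (Fact.out : p.Prime).dvd_factorial]
  omega

theorem Derivation.coeff_truncatedExp_mul [CharP k p] (D : Derivation k S S) (x y : S) :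
    ∀ n < p, (D.truncatedExp p (x * y)).coeff n =
      (D.truncatedExp p x * D.truncatedExp p y).coeff n := by
  intro n hn
  rw [coeff_mul, D.coeff_truncatedExp, if_pos hn, D.iterate_mul, Finset.smul_sum]
  refine Finset.sum_congr rfl fun ij hij => ?_
  rw [Finset.HasAntidiagonal.mem_antidiagonal] at hij
  rw [D.coeff_truncatedExp, D.coeff_truncatedExp, if_pos (by omega), if_pos (by omega),
    smul_mul_smul_comm, ← Nat.cast_smul_eq_nsmul k, smul_smul]
  congr 1
  have h1 := Nat.factorial_cast_ne_zero_of_lt (k := k) p hn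
  have h2 := Nat.factorial_cast_ne_zero_of_lt (k := k) p (n := ij.1) (by omega)
  have h3 := Nat.factorial_cast_ne_zero_of_lt (k := k) p (n := ij.2) (by omega)
  field_simp
  rw [← hij]
  have h4 := Nat.choose_mul_factorial_mul_factorial (Nat.le_add_right ij.1 ij.2)
  rw [Nat.add_sub_cancel_left] at h4
  rw [← h4]
  push_cast
  ring

theorem Derivation.coeff_truncatedExp_pow [CharP k p] (D : Derivation k S S) (x : S) (m : ℕ) :
    ∀ n < p, (D.truncatedExp p (x ^ m)).coeff n = (D.truncatedExp p x ^ m).coeff n := by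
  induction m with
  | zero =>
    intro n hn
    rcases n with _ | n
    · simp [D.coeff_truncatedExp, hn]
    · have : D^[n + 1] (1 : S) = 0 := by
        rw [Function.iterate_succ_apply, D.map_one_eq_zero]
        exact Function.iterate_fixed (map_zero D) n
      simp [D.coeff_truncatedExp, this, coeff_one]
  | succ m ih =>
    intro n hn
    rw [pow_succ, D.coeff_truncatedExp_mul p _ _ n hn, pow_succ]
    exact coeff_mul_congr ih (fun _ _ => rfl) n hn

/-- Hochschild's identity. -/
theorem Derivation.iterate_pow_mul_self [CharP k p] [CharP S p] (D : Derivation k S S) (x : S) :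
    D^[p - 1] (x ^ (p - 1) * D x) =
      ((p - 1).factorial : k) • (D x) ^ p + x ^ (p - 1) * D^[p] x := by
  have hp := (Fact.out : p.Prime)
  have hp1 := hp.one_lt
  set f := D.truncatedExp p x with hf
  have hfac := Nat.factorial_cast_ne_zero_of_lt (k := k) p (n := p - 1) (by omega)
  have key : (D.truncatedExp p (x ^ (p - 1) * D x)).coeff (p - 1) =
      (f ^ (p - 1) * (derivative f +
        monomial (p - 1) (((p - 1).factorial : k)⁻¹ • D^[p] x))).coeff (p - 1) := by
    rw [D.coeff_truncatedExp_mul p _ _ _ (by omega)]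
    refine coeff_mul_congr (D.coeff_truncatedExp_pow p x _) (fun n hn => ?_) _ (p := p) (by omega)
    rw [coeff_add, coeff_derivative, hf, D.coeff_truncatedExp, D.coeff_truncatedExp, if_pos hn,
      coeff_monomial]
    by_cases hn' : n = p - 1
    · subst hn'
      rw [if_neg (by omega), if_pos rfl, ← Function.iterate_succ_apply]
      simp [Nat.sub_add_cancel hp.one_le]
    · rw [if_pos (by omega), if_neg (Ne.symm hn'), ← Function.iterate_succ_apply, add_zero]
      have h1 := Nat.factorial_cast_ne_zero_of_lt (k := k) p hn
      have h2 := Nat.factorial_cast_ne_zero_of_lt (k := k) p (n := n + 1) (by omega)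
      have h3 : (n : S) + 1 = algebraMap k S (n + 1) := by simp
      rw [h3, mul_comm, ← Algebra.smul_def, smul_smul]
      congr 1
      rw [Nat.factorial_succ, Nat.cast_mul] at h2 ⊢
      have h4 := left_ne_zero_of_mul h2
      push_cast at h4 ⊢
      field_simp
  rw [D.coeff_truncatedExp, if_pos (by omega), mul_add, coeff_add,
    coeff_pow_mul_derivative f hp.ne_zero, coeff_char_pow_char] at key
  conv at key => enter [2, 2, 2]; rw [← Nat.zero_add (p - 1)]
  rw [coeff_mul_monomial, hf, D.coeff_truncatedExp, if_pos hp1,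
    coeff_zero_eq_eval_zero, eval_pow, ← coeff_zero_eq_eval_zero, D.coeff_truncatedExp,
    if_pos hp.pos] at key
  have := congrArg (fun z => ((p - 1).factorial : k) • z) key
  simpa [smul_smul, hfac] using this

/-- Injectivity of the inverse Cartier operator: if `∑ gⱼᵖ hⱼᵖ⁻¹ dhⱼ = dh`, then
`∑ gⱼ dhⱼ = 0`, both equalities being tested on derivations. -/
theorem Derivation.sum_mul_eq_zero_of_sum_pow_mul_eq [CharP k p] [CharP S p] [IsReduced S]
    {ι : Type*} (s : Finset ι) (g h : ι → S) (y : S)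
    (H : ∀ E : Derivation k S S, ∑ j ∈ s, g j ^ p * h j ^ (p - 1) * E (h j) = E y)
    (D : Derivation k S S) : ∑ j ∈ s, g j * D (h j) = 0 := by
  have hp := (Fact.out : p.Prime)
  have hfac := Nat.factorial_cast_ne_zero_of_lt (k := k) p (n := p - 1)
    (by have := hp.pos; omega)
  have h1 := H (D.iterateChar p)
  have h2 : D^[p - 1] (∑ j ∈ s, g j ^ p * h j ^ (p - 1) * D (h j)) = D^[p] y := by
    rw [H D, ← Function.iterate_succ_apply, Nat.succ_eq_add_one, Nat.sub_add_cancel hp.one_le]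
  have hsum : ∀ n (f : ι → S), D^[n] (∑ j ∈ s, f j) = ∑ j ∈ s, D^[n] (f j) := by
    intro n f
    induction n with
    | zero => rfl
    | succ n ih => simp only [Function.iterate_succ_apply', ih, map_sum]
  simp only [D.iterateChar_apply p] at h1
  rw [hsum, ← h1] at h2
  simp only [mul_assoc, D.iterate_pow_char_mul p, D.iterate_pow_mul_self p, mul_add,
    Finset.sum_add_distrib, add_eq_right] at h2
  simp only [mul_smul_comm, ← mul_pow, ← Finset.smul_sum] at h2
  rw [← sum_pow_char, smul_eq_zero_iff_right hfac] at h2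
  exact pow_eq_zero_iff hp.ne_zero |>.mp h2

end Hochschild

theorem isIntegral_of_pow_mem {k T : Type*} [Field k] [CommRing T] [Algebra k T]
    {p : ℕ} (hp : 0 < p) (U : Subalgebra k T) (h : ∀ t : T, t ^ p ∈ U) :
    Algebra.IsIntegral U T :=
  ⟨fun t => IsIntegral.of_pow hp (isIntegral_algebraMap (x := (⟨t ^ p, h t⟩ : U)))⟩

section KerD

variable {k T : Type*} [Field k] [CommRing T] [Algebra k T] (p : ℕ) [Fact p.Prime]

open KaehlerDifferential in
/-- A subalgebra containing all `p`-th powers and such that the algebra is unramified over it is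
everything. -/
theorem Subalgebra.eq_top_of_formallyUnramified [CharP k p] [Algebra.FiniteType k T]
    (U : Subalgebra k T) (h : ∀ t : T, t ^ p ∈ U) [Algebra.FormallyUnramified U T] : U = ⊤ := by
  nontriviality T
  have hp := (Fact.out : p.Prime)
  have : Algebra.FiniteType U T := .of_restrictScalars_finiteType k U T
  have := isIntegral_of_pow_mem hp.pos U h
  have : Module.Finite U T := Algebra.IsIntegral.finite
  obtain ⟨t, ht, ht1⟩ := Algebra.FormallyUnramified.iff_exists_tensorProduct (R := U) (S := T) |>.mp
    inferInstance
  have : Nontrivial (T ⊗[U] T) := (Algebra.TensorProduct.lmul' U (S := T)).toRingHom.domain_nontrivial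
  have : CharP (T ⊗[U] T) p :=
    charP_of_injective_algebraMap (algebraMap k (T ⊗[U] T)).injective p
  have hnil : ideal U T ≤ nilradical (T ⊗[U] T) := by
    rw [← span_range_eq_ideal, Ideal.span_le]
    rintro _ ⟨s, rfl⟩
    refine ⟨p, ?_⟩
    have hs : s ^ p = (⟨s ^ p, h s⟩ : U) • (1 : T) := by simp [Algebra.smul_def]
    simp only [sub_pow_char, Algebra.TensorProduct.tmul_pow, one_pow]
    rw [hs, TensorProduct.smul_tmul, sub_self]
    exact Submodule.zero_mem _
  have hunit : IsUnit t := by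
    have h1 : IsNilpotent (1 - t) := mem_nilradical.mp <| hnil <| by
      rw [ideal, RingHom.mem_ker]; simp [ht1]
    simpa using h1.isUnit_one_sub
  have hepi : Algebra.IsEpi U T := (Algebra.isEpi_iff_forall_one_tmul_eq U T).mpr fun a =>
    sub_eq_zero.mp (hunit.mul_left_eq_zero.mp (ht a))
  have hsurj := Algebra.isEpi_iff_surjective_algebraMap_of_finite.mp hepi
  rw [eq_top_iff]
  intro a _
  obtain ⟨u, rfl⟩ := hsurj a
  exact u.2

open Polynomial in
theorem Derivation.map_aeval_of_forall_eq_zero (U : Subalgebra k T) (E : Derivation k T T)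
    (hE : ∀ u ∈ U, E u = 0) (x : T) (hx : E x = 1) (q : U[X]) :
    E (aeval x q) = aeval x (derivative q) := by
  induction q using Polynomial.induction_on' with
  | add f g hf hg => simp [hf, hg]
  | monomial n a =>
    rw [derivative_monomial, aeval_monomial, aeval_monomial, E.leibniz, E.leibniz_pow, hx]
    have : E (algebraMap U T a) = 0 := hE _ a.2
    simp only [this, smul_eq_mul, map_mul, nsmul_eq_mul]
    rw [_root_.map_natCast (algebraMap U T) n]
    ring

open Polynomial in
theorem mem_of_mem_adjoin_insert [CharP k p] (U : Subalgebra k T) (hU : ∀ t : T, t ^ p ∈ U)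
    (E : Derivation k T T) (hE : ∀ u ∈ U, E u = 0) (x : T) (hx : E x = 1) {y : T}
    (hy : y ∈ (aeval x : U[X] →ₐ[U] T).range) (hEy : E y = 0) : y ∈ U := by
  nontriviality T
  have hp := (Fact.out : p.Prime)
  obtain ⟨q, rfl⟩ := hy
  set f : U[X] := X ^ p - C ⟨x ^ p, hU x⟩ with hf
  have hmonic : f.Monic := monic_X_pow_sub_C _ hp.ne_zero
  have hroot : aeval x f = 0 := by simp [hf]
  have hdeg : (q %ₘ f).natDegree < p := by
    have := natDegree_modByMonic_lt q hmonic (by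
      intro h1
      have := natDegree_X_pow_sub_C (n := p) (r := (⟨x ^ p, hU x⟩ : U))
      rw [← hf, h1, natDegree_one] at this
      exact hp.ne_zero this.symm)
    rwa [hf, natDegree_X_pow_sub_C] at this
  have hq : aeval x q = aeval x (q %ₘ f) := by
    conv_lhs => rw [← modByMonic_add_div q f]
    simp [hroot]
  change E (aeval x q) = 0 at hEy
  change aeval x q ∈ U
  rw [hq] at hEy ⊢
  generalize q %ₘ f = r at *
  have hiter (n : ℕ) : E^[n] (aeval x r) = aeval x (derivative^[n] r) := by
    induction n with
    | zero => rfl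
    | succ n ih => rw [Function.iterate_succ_apply', ih, Function.iterate_succ_apply',
        E.map_aeval_of_forall_eq_zero U hE x hx]
  by_cases h0 : r.natDegree = 0
  · rw [eq_C_of_natDegree_eq_zero h0, aeval_C]
    exact (r.coeff 0).2
  exfalso
  have h1 := hiter r.natDegree
  obtain ⟨m, hm⟩ := Nat.exists_eq_succ_of_ne_zero h0
  have h2 : E^[r.natDegree] (aeval x r) = 0 := by
    rw [hm, Function.iterate_succ_apply, hEy]
    exact Function.iterate_fixed (map_zero E) m
  have h3 : (derivative^[r.natDegree] r).natDegree = 0 :=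
    Nat.le_zero.mp <| (natDegree_iterate_derivative r _).trans (by simp)
  rw [h2, eq_C_of_natDegree_eq_zero h3, aeval_C, coeff_iterate_derivative, zero_add,
    Nat.descFactorial_self, map_nsmul, nsmul_eq_mul] at h1
  have h4 : IsUnit ((r.natDegree.factorial : ℕ) : T) := by
    have := (Nat.factorial_cast_ne_zero_of_lt (k := k) p hdeg).isUnit.map (algebraMap k T)
    rwa [map_natCast] at this
  have h5 : algebraMap U T r.leadingCoeff = 0 := h4.mul_right_eq_zero.mp h1.symm
  have h6 : r.leadingCoeff = 0 := Subtype.ext h5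
  rw [leadingCoeff_eq_zero] at h6
  exact h0 (by rw [h6, natDegree_zero])
end KerD

/-- The subalgebra generated by all `p`-th powers and the `x i` with `i ∈ J`. -/
def adjoinPow {I : Type*} (k : Type*) {T : Type*} [Field k] [CommRing T] [Algebra k T] (p : ℕ)
    (x : I → T) (J : Set I) : Subalgebra k T :=
  Algebra.adjoin k (Set.range (fun t : T => t ^ p) ∪ x '' J)

theorem pow_mem_adjoinPow {k T I : Type*} [Field k] [CommRing T] [Algebra k T] (p : ℕ)
    (x : I → T) (J : Set I) (t : T) : t ^ p ∈ adjoinPow k p x J :=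
  Algebra.subset_adjoin (Or.inl ⟨t, rfl⟩)

section AdjoinPow

variable {k T I : Type*} [Field k] [CommRing T] [Algebra k T] (p : ℕ) [Fact p.Prime]

theorem exists_pow_eq_of_mem_adjoinPow_empty [CharP k p] [CharP T p] [ExpChar k p]
    [PerfectRing k p] (x : I → T) {y : T} (hy : y ∈ adjoinPow k p x ∅) : ∃ a, a ^ p = y := by
  rw [adjoinPow, Set.image_empty, Set.union_empty] at hy
  induction hy using Algebra.adjoin_induction with
  | mem _ h => exact h
  | algebraMap r =>
    obtain ⟨c, rfl⟩ := surjective_frobenius k p r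
    exact ⟨algebraMap k T c, by rw [frobenius_def, map_pow]⟩
  | add _ _ _ _ hx hy =>
    obtain ⟨a, rfl⟩ := hx
    obtain ⟨b, rfl⟩ := hy
    exact ⟨a + b, add_pow_char a b p⟩
  | mul _ _ _ _ hx hy =>
    obtain ⟨a, rfl⟩ := hx
    obtain ⟨b, rfl⟩ := hy
    exact ⟨a * b, mul_pow a b p⟩

theorem mem_adjoinPow_of_mem_insert [CharP k p] [CharP T p] (x : I → T) (J : Set I) (j : I)
    (E : Derivation k T T) (hE : ∀ i ∈ J, E (x i) = 0) (hx : E (x j) = 1) {y : T}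
    (hy : y ∈ adjoinPow k p x (insert j J)) (hEy : E y = 0) : y ∈ adjoinPow k p x J := by
  refine mem_of_mem_adjoin_insert p _ (pow_mem_adjoinPow p x J) E (fun u hu => ?_) (x j) hx ?_ hEy
  · induction hu using Algebra.adjoin_induction with
    | mem _ h =>
      rcases h with ⟨t, rfl⟩ | ⟨i, hi, rfl⟩
      · exact E.map_pow_char p t
      · exact hE i hi
    | algebraMap r => exact E.map_algebraMap r
    | add _ _ _ _ hx hy => rw [map_add, hx, hy, add_zero]
    | mul _ _ _ _ hx hy => rw [E.leibniz, hx, hy, smul_zero, smul_zero, add_zero]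
  · suffices h : adjoinPow k p x (insert j J) ≤ ((Polynomial.aeval (x j) :
        Polynomial (adjoinPow k p x J) →ₐ[adjoinPow k p x J] T).range).restrictScalars k from h hy
    refine Algebra.adjoin_le ?_
    rintro _ (⟨t, rfl⟩ | ⟨i, hi | hi, rfl⟩)
    · exact ⟨Polynomial.C ⟨t ^ p, pow_mem_adjoinPow p x J t⟩, by simp⟩
    · exact ⟨Polynomial.X, by simp [hi]⟩
    · exact ⟨Polynomial.C ⟨x i, Algebra.subset_adjoin (Or.inr ⟨i, hi, rfl⟩)⟩, by simp⟩

open KaehlerDifferential in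
theorem adjoinPow_univ [CharP k p] [Algebra.FiniteType k T] (b : Module.Basis I T Ω[T⁄k]) (x : I → T)
    (hx : ∀ i, D k T (x i) = b i) : adjoinPow k p x Set.univ = ⊤ := by
  have : Algebra.FormallyUnramified (adjoinPow k p x Set.univ) T := by
    rw [Algebra.formallyUnramified_iff]
    set U := adjoinPow k p x Set.univ
    have h : KaehlerDifferential.map k U T T = 0 := by
      refine b.ext fun i => ?_
      rw [← hx, map_D]
      have : x i ∈ U := Algebra.subset_adjoin (Or.inr ⟨i, trivial, rfl⟩)
      exact (D U T).map_algebraMap ⟨x i, this⟩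
    refine ⟨fun u v => ?_⟩
    obtain ⟨u, rfl⟩ := map_surjective k U T u
    obtain ⟨v, rfl⟩ := map_surjective k U T v
    rw [h]; rfl
  exact Subalgebra.eq_top_of_formallyUnramified p _ (pow_mem_adjoinPow p x _)

open KaehlerDifferential in
theorem exists_pow_eq_of_D_eq_zero_of_basis [CharP k p] [ExpChar k p] [PerfectRing k p]
    [Algebra.FiniteType k T] (b : Module.Basis I T Ω[T⁄k]) (hb : Set.range b ⊆ Set.range (D k T))
    {y : T} (hy : D k T y = 0) : ∃ a, a ^ p = y := by
  classical
  rcases subsingleton_or_nontrivial T with _ | _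
  · exact ⟨0, Subsingleton.elim _ _⟩
  have : CharP T p := charP_of_injective_algebraMap (algebraMap k T).injective p
  have : Finite I := Module.Finite.finite_basis b
  cases nonempty_fintype I
  choose x hx using fun i => hb ⟨i, rfl⟩
  have key (J : Finset I) : y ∈ adjoinPow k p x (J : Set I) → ∃ a, a ^ p = y := by
    induction J using Finset.induction_on with
    | empty =>
      rw [Finset.coe_empty]
      exact exists_pow_eq_of_mem_adjoinPow_empty p x
    | insert j J hj ih =>
      rw [Finset.coe_insert]
      intro h
      refine ih (mem_adjoinPow_of_mem_insert p x J j ((b.coord j).compDer (D k T))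
        (fun i hi => ?_) ?_ h ?_)
      · have : i ≠ j := fun h => hj (h ▸ hi)
        simp [hx, this]
      · simp [hx]
      · simp [hy]
  refine key Finset.univ ?_
  rw [Finset.coe_univ, adjoinPow_univ p b x hx]
  trivial

end AdjoinPow

section Smooth

variable {k S : Type*} [Field k] [CommRing S] [Algebra k S]

open Polynomial in
theorem Polynomial.eq_C_of_isIntegral {g : k[X]} (hg : IsIntegral k g) : g = C (g.coeff 0) := by
  obtain ⟨q, hq, h⟩ := hg
  have h' : q.comp g = 0 := h
  exact ((comp_eq_zero_iff.mp h').resolve_left hq.ne_zero).2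

open Polynomial in
/-- A smooth algebra over a field is reduced. -/
theorem Algebra.Smooth.isReduced_of_field [Algebra.Smooth k S] : IsReduced S := by
  refine ⟨fun f hf => ?_⟩
  obtain ⟨m, hm⟩ := hf
  have hint : IsIntegral S (f ⊗ₜ[k] (X : k[X])) :=
    ⟨X ^ (m + 1), monic_X_pow _, by
      simp [Algebra.TensorProduct.tmul_pow, pow_succ f, hm]⟩
  obtain ⟨z, hz⟩ := (TensorProduct.toIntegralClosure_bijective_of_smooth (R := k) (S := S)
    (B := k[X])).2 ⟨_, hint⟩
  let φ : S ⊗[k] k[X] →ₗ[k] S :=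
    (_root_.TensorProduct.rid k S).toLinearMap ∘ₗ (lcoeff k 1).lTensor S
  have hφ (z : S ⊗[k] integralClosure k k[X]) :
      φ (TensorProduct.toIntegralClosure k S k[X] z : S ⊗[k] k[X]) = 0 := by
    induction z with
    | zero => simp
    | add x y hx hy => rw [map_add, Subalgebra.coe_add, map_add, hx, hy, add_zero]
    | tmul x y =>
      have hy : (y : k[X]) = C ((y : k[X]).coeff 0) := eq_C_of_isIntegral y.2
      have : (TensorProduct.toIntegralClosure k S k[X] (x ⊗ₜ y) : S ⊗[k] k[X]) =
        x ⊗ₜ (y : k[X]) := rfl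
      rw [this, hy]
      simp [φ]
  have := hφ z
  rw [hz] at this
  simpa [φ] using this

open KaehlerDifferential in
/-- On a smooth algebra over a perfect field, the kernel of `d` consists of `p`-th powers. -/
theorem Algebra.Smooth.exists_pow_eq_of_D_eq_zero (p : ℕ) [Fact p.Prime] [CharP k p] [ExpChar k p]
    [PerfectRing k p] [Algebra.Smooth k S] {y : S} (hy : D k S y = 0) : ∃ a, a ^ p = y := by
  rcases subsingleton_or_nontrivial S with _ | _
  · exact ⟨0, Subsingleton.elim _ _⟩
  have hp := (Fact.out : p.Prime)
  have : CharP S p := charP_of_injective_algebraMap (algebraMap k S).injective p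
  let J : Ideal S :=
    { carrier := {r | ∃ a, a ^ p = r ^ p * y}
      zero_mem' := ⟨0, by simp [hp.ne_zero]⟩
      add_mem' := by
        rintro r s ⟨a, ha⟩ ⟨b, hb⟩
        exact ⟨a + b, by rw [add_pow_char, add_pow_char, ha, hb, add_mul]⟩
      smul_mem' := by
        rintro c r ⟨a, ha⟩
        exact ⟨c * a, by rw [mul_pow, ha, smul_eq_mul, mul_pow, mul_assoc]⟩ }
  obtain ⟨s, hs, hst⟩ := Algebra.Smooth.exists_span_eq_top_isStandardSmooth k S
  have hpow : ∀ x ∈ s, ∃ N : ℕ, x ^ N ∈ J := by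
    intro x hx
    have := hst x hx
    obtain ⟨-, I, b, hb⟩ := Algebra.IsStandardSmooth.iff_exists_basis_kaehlerDifferential
      (R := k) (S := Localization.Away x) |>.mp this
    have hy' : D k (Localization.Away x) (algebraMap S _ y) = 0 := by
      rw [← KaehlerDifferential.map_D k k, hy, map_zero]
    obtain ⟨a, ha⟩ := exists_pow_eq_of_D_eq_zero_of_basis p b hb hy'
    obtain ⟨⟨a, ⟨_, N, rfl⟩⟩, h⟩ := IsLocalization.surj (Submonoid.powers x) a
    have h2 : algebraMap S (Localization.Away x) (a ^ p) =
        algebraMap S _ ((x ^ N) ^ p * y) := by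
      rw [map_pow, ← h, mul_pow, ha, map_mul, mul_comm, map_pow,
        map_pow, map_pow]
    obtain ⟨⟨_, M, rfl⟩, h3⟩ := (IsLocalization.eq_iff_exists (Submonoid.powers x) _).mp h2
    refine ⟨M + N, x ^ M * a, ?_⟩
    dsimp only at h3
    obtain ⟨q, rfl⟩ := Nat.exists_eq_add_one_of_ne_zero hp.ne_zero
    calc (x ^ M * a) ^ (q + 1) = (x ^ M) ^ q * (x ^ M * a ^ (q + 1)) := by ring
      _ = _ := by rw [h3]; ring
  have hJ : J = ⊤ := by
    by_contra hne
    obtain ⟨m, hm, hle⟩ := Ideal.exists_le_maximal J hne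
    refine hm.ne_top (top_le_iff.mp (hs ▸ Ideal.span_le.mpr fun x hx => ?_))
    obtain ⟨N, hN⟩ := hpow x hx
    exact hm.isPrime.mem_of_pow_mem N (hle hN)
  obtain ⟨a, ha⟩ : (1 : S) ∈ J := hJ ▸ trivial
  exact ⟨a, by rw [ha, one_pow, one_mul]⟩

end Smooth

section Commutator

variable {A : Type*} [Ring A]

theorem pow_mul_eq_of_mul_eq (M : Subring A) (q : ℤ) {x b e₀ e₁ e₂ : A} (hx : x ∈ M)
    (he₂ : e₂ ∈ M) (h0 : x * b = b * x + q • e₀) (h1 : x * e₀ = e₀ * x + q • e₁)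
    (h2 : x * e₁ = e₁ * x + q • e₂) (m : ℕ) :
    ∃ h ∈ M, x ^ (m + 2) * b = b * x ^ (m + 2) + (q * (m + 2 : ℕ)) • (e₀ * x ^ (m + 1)) +
      (q ^ 2 * ((m + 2).choose 2 : ℕ)) • (e₁ * x ^ m) + q ^ 3 • h := by
  induction m with
  | zero =>
    refine ⟨0, M.zero_mem, ?_⟩
    have : x ^ (0 + 2) * b = x * (x * b) := by rw [zero_add, pow_two, mul_assoc]
    rw [this, h0, mul_add, ← mul_assoc, h0, mul_smul_comm, h1, add_mul, smul_mul_assoc]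
    simp only [zero_add, pow_one, pow_zero, mul_one, Nat.choose_self, pow_two, mul_assoc]
    push_cast
    module
  | succ m ih =>
    obtain ⟨h, hh, ih⟩ := ih
    refine ⟨((m + 2).choose 2 : ℤ) • (e₂ * x ^ m) + x * h,
      M.add_mem (M.zsmul_mem (M.mul_mem he₂ (M.pow_mem hx _)) _) (M.mul_mem hx hh), ?_⟩
    rw [show m + 1 + 2 = (m + 2) + 1 from rfl, pow_succ' x (m + 2), mul_assoc, ih,
      Nat.choose_succ_succ' (m + 2) 1, Nat.choose_one_right]
    simp only [mul_add, mul_smul_comm, ← mul_assoc, h0, h1, h2, add_mul, smul_mul_assoc]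
    simp only [mul_assoc, ← pow_succ']
    push_cast
    module

/-- If `[x, -]` is divisible by `p ^ j`, then `[x ^ p, b]` is `[x, b] * x ^ (p - 1) * p` up to
higher order. -/
theorem pow_prime_mul_sub_mul {p : ℕ} [Fact p.Prime] (hp : 2 < p) (M : Subring A) {j : ℕ}
    (hj : 1 ≤ j) {x : A} (hx : x ∈ M)
    (H : ∀ b ∈ M, ∃ e ∈ M, x * b - b * x = (p : A) ^ j * e) {b e₀ : A} (he₀ : e₀ ∈ M)
    (h0 : x * b - b * x = (p : A) ^ j * e₀) :
    ∃ f ∈ M, x ^ p * b - b * x ^ p = (p : A) ^ (j + 1) * (e₀ * x ^ (p - 1) + p * f) := by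
  obtain ⟨e₁, he₁, h1⟩ := H e₀ he₀
  obtain ⟨e₂, he₂, h2⟩ := H e₁ he₁
  have key (y : A) (i : ℕ) : (p : A) ^ i * y = ((p : ℤ) ^ i) • y := by
    rw [zsmul_eq_mul]; push_cast; rfl
  rw [key, sub_eq_iff_eq_add'] at h0 h1 h2
  obtain ⟨m, rfl⟩ := Nat.exists_eq_add_of_le' hp.le
  obtain ⟨h, hh, e⟩ := pow_mul_eq_of_mul_eq M _ hx he₂ h0 h1 h2 m
  obtain ⟨c, hc⟩ := (Fact.out : (m + 2).Prime).dvd_choose_self (k := 2) (by norm_num) hp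
  obtain ⟨i, rfl⟩ := Nat.exists_eq_add_of_le' hj
  refine ⟨((m + 2 : ℕ) ^ i * c : ℤ) • (e₁ * x ^ m) + ((m + 2 : ℕ) ^ (2 * i) : ℤ) • h,
    M.add_mem (M.zsmul_mem (M.mul_mem he₁ (M.pow_mem hx _)) _) (M.zsmul_mem hh _), ?_⟩
  have hpow : (((m + 2 : ℕ) : A)) = ((m + 2 : ℕ) : A) ^ 1 := (pow_one _).symm
  rw [e, hc, key, hpow, key, show m + 2 - 1 = m + 1 from rfl]
  push_cast
  module

theorem pow_prime_pow_mul_sub_mul {p : ℕ} [Fact p.Prime] (hp : 2 < p) (M : Subring A) {x : A}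
    (hx : x ∈ M) (H : ∀ b ∈ M, ∃ e ∈ M, x * b - b * x = (p : A) * e) (m : ℕ) {b e₀ : A}
    (he₀ : e₀ ∈ M) (h0 : x * b - b * x = (p : A) * e₀) :
    ∃ f ∈ M, x ^ p ^ m * b - b * x ^ p ^ m =
      (p : A) ^ (m + 1) * (e₀ * x ^ (p ^ m - 1) + p * f) := by
  induction m generalizing b e₀ with
  | zero => exact ⟨0, M.zero_mem, by simpa using h0⟩
  | succ m ih =>
    obtain ⟨f, hf, h⟩ := ih he₀ h0
    have hpf (f : A) (hf : f ∈ M) : (p : A) * f ∈ M := M.mul_mem (natCast_mem M p) hf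
    have hy := M.pow_mem hx (p ^ m)
    obtain ⟨f', hf', h'⟩ := pow_prime_mul_sub_mul hp M (j := m + 1) (by omega) hy
      (fun b hb => by
        obtain ⟨e, he, h⟩ := H b hb
        obtain ⟨f, hf, h⟩ := ih he h
        exact ⟨_, M.add_mem (M.mul_mem he (M.pow_mem hx _)) (hpf f hf), h⟩)
      (M.add_mem (M.mul_mem he₀ (M.pow_mem hx _)) (hpf f hf)) h
    refine ⟨f * (x ^ p ^ m) ^ (p - 1) + f', M.add_mem (M.mul_mem hf (M.pow_mem hy _)) hf', ?_⟩
    have hpos : 1 ≤ p ^ m := Nat.one_le_pow _ _ (by omega)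
    have hexp : p ^ (m + 1) - 1 = (p ^ m - 1) + p ^ m * (p - 1) := by
      rw [Nat.mul_sub, mul_one, ← pow_succ]
      have : p ^ m ≤ p ^ (m + 1) := Nat.pow_le_pow_right (by omega) (by omega)
      omega
    rw [hexp, pow_add x, pow_mul x, pow_succ p, pow_mul, h', add_mul, mul_add (p : A) _ f',
      mul_assoc, mul_assoc]
    simp only [add_assoc]

end Commutator

section Flat

theorem TruncatedWittVector.natCast_pow_eq_zero (p : ℕ) [Fact p.Prime] (n : ℕ) (k : Type*)
    [CommRing k] [CharP k p] : (p : TruncatedWittVector p n k) ^ n = 0 := by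
  have h : ((p : WittVector p k) ^ n) ∈ RingHom.ker (WittVector.truncate n) := by
    rw [WittVector.mem_ker_truncate]
    intro i hi
    have := WittVector.mul_pow_charP_coeff_zero (p := p) (R := k) 1 hi
    rwa [one_mul] at this
  have h' := (RingHom.mem_ker).mp h
  rwa [map_pow, map_natCast] at h'

theorem TruncatedWittVector.eq_pow_mul_of_mul_eq_zero (p : ℕ) [Fact p.Prime] (n : ℕ) (k : Type*)
    [Field k] [CharP k p] [ExpChar k p] [PerfectRing k p] (x : TruncatedWittVector p n k)
    (hx : (p : TruncatedWittVector p n k) * x = 0) :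
    ∃ y, x = (p : TruncatedWittVector p n k) ^ (n - 1) * y := by
  obtain ⟨X, rfl⟩ := WittVector.truncate_surjective p n k x
  have h : X * (p : WittVector p k) ∈ RingHom.ker (WittVector.truncate n) := by
    rw [RingHom.mem_ker, map_mul, map_natCast, mul_comm, hx]
  rw [WittVector.mem_ker_truncate] at h
  by_cases hX : X = 0
  · exact ⟨0, by simp [hX]⟩
  obtain ⟨m, b, hb, rfl⟩ := WittVector.exists_eq_pow_p_mul X hX
  have hm : n - 1 ≤ m := by
    by_contra! hlt
    have h1 := h (m + 1) (by omega)
    rw [mul_comm _ b, mul_assoc, ← pow_succ] at h1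
    have h2 := WittVector.mul_pow_charP_coeff_succ (p := p) b (m := 0) (n := m + 1)
    rw [zero_add, h1] at h2
    exact hb (eq_zero_of_pow_eq_zero h2.symm)
  obtain ⟨j, rfl⟩ := Nat.exists_eq_add_of_le hm
  exact ⟨WittVector.truncate n ((p : WittVector p k) ^ j * b), by simp [pow_add, mul_assoc]⟩

variable {W A : Type*} [CommRing W] [Ring A] [Algebra W A] [Module.Flat W A] {p n : ℕ}

theorem Module.Flat.eq_pow_mul_of_mul_eq_zero
    (h : ∀ x : W, (p : W) * x = 0 → ∃ y, x = (p : W) ^ (n - 1) * y) (c : A)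
    (hc : (p : A) * c = 0) : ∃ d, c = (p : A) ^ (n - 1) * d := by
  have h0 : ∑ i : Unit, (fun _ => (p : W)) i • (fun _ => c) i = 0 := by
    simpa [Algebra.smul_def] using hc
  obtain ⟨κ, a, y, hy, ha⟩ := Module.Flat.isTrivialRelation_of_sum_smul_eq_zero
    (R := W) (M := A) (ι := Unit) (f := fun _ => (p : W)) (x := fun _ => c) h0
  have ha' (j) : (p : W) * a () j = 0 := by simpa using ha j
  choose z hz using fun j => h _ (ha' j)
  refine ⟨∑ j, z j • y j, ?_⟩
  refine (hy ()).trans ?_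
  rw [Finset.mul_sum]
  refine Finset.sum_congr rfl fun j _ => ?_
  rw [hz, Algebra.smul_def, Algebra.smul_def, map_mul, map_pow, map_natCast, mul_assoc]

theorem Module.Flat.eq_pow_mul_of_pow_mul_eq_zero
    (h : ∀ x : W, (p : W) * x = 0 → ∃ y, x = (p : W) ^ (n - 1) * y) (j : ℕ) (hj : j ≤ n) (c : A)
    (hc : (p : A) ^ j * c = 0) : ∃ d, c = (p : A) ^ (n - j) * d := by
  induction j generalizing c with
  | zero => exact ⟨0, by simpa using hc⟩
  | succ j ih =>
    rw [pow_succ, mul_assoc] at hc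
    obtain ⟨d, hd⟩ := ih (by omega) _ hc
    have h1 : (p : A) * (c - (p : A) ^ (n - (j + 1)) * d) = 0 := by
      rw [mul_sub, hd, ← mul_assoc, ← pow_succ', show n - (j + 1) + 1 = n - j by omega, sub_self]
    obtain ⟨e, he⟩ := eq_pow_mul_of_mul_eq_zero h _ h1
    refine ⟨d + (p : A) ^ j * e, ?_⟩
    rw [mul_add, ← mul_assoc, ← pow_add, show n - (j + 1) + j = n - 1 by omega, ← he]
    abel

end Flat

section Center

theorem Derivation.apply_eq_zero_of_sum_pow_mul_eq_zero {k S : Type*} [Field k] [CommRing S]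
    [Algebra k S] (p : ℕ) [Fact p.Prime] [CharP k p] [CharP S p] [IsReduced S] (m : ℕ)
    (t : ℕ → S) (h : ∀ D : Derivation k S S,
      ∑ i ∈ Finset.range (m + 1), t i ^ (p ^ (m - i) - 1) * D (t i) = 0)
    (D : Derivation k S S) : D (t 0) = 0 := by
  induction m generalizing D with
  | zero => simpa using h D
  | succ m ih =>
    refine ih (fun D => Derivation.sum_mul_eq_zero_of_sum_pow_mul_eq p (Finset.range (m + 1))
      (fun i => t i ^ (p ^ (m - i) - 1)) t (-t (m + 1)) (fun E => ?_) D) D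
    rw [map_neg, eq_neg_iff_add_eq_zero, ← h E, Finset.sum_range_succ _ (m + 1)]
    congr 1
    · refine Finset.sum_congr rfl fun i hi => ?_
      have hi' : m + 1 - i = m - i + 1 := by
        rw [Finset.mem_range] at hi
        omega
      have hp := (Fact.out : p.Prime).two_le
      have hpos : 1 ≤ p ^ (m - i) := Nat.one_le_pow _ _ (by omega)
      have hle : p ≤ p ^ (m - i) * p := Nat.le_mul_of_pos_left p hpos
      rw [← pow_mul, ← pow_add, hi', pow_succ, Nat.sub_mul]
      congr 2
      omega
    · simp

theorem SymplecticPoisson.exists_pow_eq_of_sum_eq_zero {k S : Type u} [Field k] [CommRing S]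
    [Algebra k S] [Algebra.Smooth k S] (P : SymplecticPoisson k S) (p : ℕ) [Fact p.Prime]
    [CharP k p] [ExpChar k p] [PerfectRing k p] (m : ℕ) (t : ℕ → S)
    (h : ∀ s, ∑ i ∈ Finset.range (m + 1), t i ^ (p ^ (m - i) - 1) * P.bracket (t i) s = 0) :
    ∃ a, a ^ p = t 0 := by
  rcases subsingleton_or_nontrivial S with _ | _
  · exact ⟨0, Subsingleton.elim _ _⟩
  have : CharP S p := charP_of_injective_algebraMap (algebraMap k S).injective p
  have : IsReduced S := Algebra.Smooth.isReduced_of_field (k := k)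
  obtain ⟨ι, hι⟩ := P.nondeg
  have hι' (f x : S) : ι (KaehlerDifferential.D k S f) x = P.bracket f x := by
    have := hι f 1 x
    rwa [one_smul, one_mul] at this
  have h1 : ∑ i ∈ Finset.range (m + 1),
      t i ^ (p ^ (m - i) - 1) • KaehlerDifferential.D k S (t i) = 0 := by
    apply ι.injective
    ext s
    rw [map_zero, Derivation.zero_apply, ← h s, map_sum]
    exact (congrFun (map_sum (Derivation.coeFnAddMonoidHom (R := k) (A := S) (M := S)) _ _) s).trans
      ((Finset.sum_apply _ _ _).trans (Finset.sum_congr rfl fun i _ => hι _ _ _))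
  have h2 := Derivation.apply_eq_zero_of_sum_pow_mul_eq_zero p m t fun D => by
    have := congrArg D.liftKaehlerDifferential h1
    simpa using this
  refine Algebra.Smooth.exists_pow_eq_of_D_eq_zero p (k := k) (ι.injective ?_)
  ext b
  rw [hι', map_zero, Derivation.zero_apply, P.antisymm, ← hι', h2, neg_zero]

variable {A A₁ S : Type*} [Ring A] [Ring A₁] [CommRing S] {i : S →+* A₁} {p n : ℕ}

/-- The commutators of `w` are divisible by `p ^ m`. -/
def IsCentralModPow (p : ℕ) (m : ℕ) (w : A) : Prop :=
  ∀ b : A, ∃ c : A, w * b - b * w = (p : A) ^ m * c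

theorem IsCentralModPow.pow_of_map_mem_center [Fact p.Prime] (hp : 2 < p) (π : A →+* A₁)
    (hker : ∀ a : A, π a = 0 → ∃ b : A, a = (p : A) * b) {a : A}
    (ha : π a ∈ Subring.center A₁) (m : ℕ) : IsCentralModPow p (m + 1) (a ^ p ^ m) := by
  have H (b : A) : ∃ e, a * b - b * a = (p : A) * e :=
    hker _ (by rw [map_sub, map_mul, map_mul, Subring.mem_center_iff.mp ha, sub_self])
  intro b
  obtain ⟨e, he⟩ := H b
  obtain ⟨f, -, h⟩ := pow_prime_pow_mul_sub_mul hp ⊤ (Subring.mem_top a)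
    (fun b _ => by
      obtain ⟨e, he⟩ := H b
      exact ⟨e, trivial, he⟩) m trivial he
  exact ⟨_, h⟩

theorem IsCentralModPow.exists_map_eq_and_exists_eq_sum [Fact p.Prime] (hp : 2 < p)
    (hi : Function.Injective i)
    (hcen : ∀ x, x ∈ Subring.center A₁ ↔ ∃ s, x = i s) (br : S → S → S)
    (hcartier : ∀ (m : ℕ) (t : ℕ → S),
      (∀ s, ∑ j ∈ Finset.range (m + 1), t j ^ (p ^ (m - j) - 1) * br (t j) s = 0) →
      ∃ a, a ^ p = t 0)
    (hflat : ∀ j ≤ n, ∀ c : A, (p : A) ^ j * c = 0 → ∃ d, c = (p : A) ^ (n - j) * d)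
    (π : A →+* A₁) (hsurj : Function.Surjective π)
    (hker : ∀ a : A, π a = 0 ↔ ∃ b : A, a = (p : A) * b)
    (hbr : ∀ (a b : A) (s t : S), π a = i s → π b = i t →
      ∃ c : A, (p : A) * c = a * b - b * a ∧ π c = i (br s t))
    (l : S → A) (hl : ∀ s, π (l s) = i s) (m : ℕ) (hm : m < n) :
    (∀ w : A, IsCentralModPow p m w → ∃ (t : ℕ → S) (a : A),
      w = ∑ j ∈ Finset.range m, (p : A) ^ j * l (t j) ^ p ^ (m - 1 - j) + (p : A) ^ m * a) ∧
    (∀ w : A, IsCentralModPow p (m + 1) w → ∃ t : S, π w = i (t ^ p ^ m)) := by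
  have hπp : π (p : A) = 0 := (hker _).mpr ⟨1, (mul_one _).symm⟩
  have hpc (j : ℕ) (x y : A) : x * ((p : A) ^ j * y) = (p : A) ^ j * (x * y) := by
    rw [← mul_assoc, ← ((Nat.cast_commute p x).pow_left j).eq, mul_assoc]
  have hlc (s : S) : π (l s) ∈ Subring.center A₁ := (hcen _).mpr ⟨s, hl s⟩
  induction m with
  | zero =>
    refine ⟨fun w _ => ⟨fun _ => 0, w, by simp⟩, fun w hw => ?_⟩
    have : π w ∈ Subring.center A₁ := by
      rw [Subring.mem_center_iff]
      intro x
      obtain ⟨b, rfl⟩ := hsurj x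
      obtain ⟨c, hc⟩ := hw b
      have := congrArg π hc
      rw [map_sub, map_mul, map_mul, map_mul, zero_add, pow_one, hπp, zero_mul] at this
      exact (sub_eq_zero.mp this).symm
    obtain ⟨s, hs⟩ := (hcen _).mp this
    exact ⟨s, by simpa using hs⟩
  | succ m ih =>
    obtain ⟨ih1, ih2⟩ := ih (by omega)
    have hdec : ∀ w : A, IsCentralModPow p (m + 1) w → ∃ (t : ℕ → S) (a : A),
        w = ∑ j ∈ Finset.range (m + 1), (p : A) ^ j * l (t j) ^ p ^ (m - j) +
          (p : A) ^ (m + 1) * a := by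
      intro w hw
      obtain ⟨s, hs⟩ := ih2 w hw
      obtain ⟨w', hw'⟩ := (hker (w - l s ^ p ^ m)).mp (by
        rw [map_sub, map_pow, hl, hs, map_pow, sub_self])
      have hcw : IsCentralModPow p m w' := by
        intro b
        obtain ⟨c, hc⟩ := hw b
        obtain ⟨c', hc'⟩ :=
          IsCentralModPow.pow_of_map_mem_center hp π (fun a => (hker a).mp) (hlc s) m b
        have h0 : (p : A) ^ 1 * ((w' * b - b * w') - (p : A) ^ m * (c - c')) = 0 := by
          have h1 : (p : A) ^ 1 * (w' * b - b * w') =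
              (p : A) ^ (m + 1) * c - (p : A) ^ (m + 1) * c' := by
            rw [← hc, ← hc', mul_sub, ← hpc 1 b, pow_one, ← mul_assoc (p : A) w' b, ← hw']
            noncomm_ring
          rw [mul_sub, h1, ← mul_assoc, ← pow_add, mul_sub, add_comm 1 m, sub_self]
        obtain ⟨d, hd⟩ := hflat 1 (by omega) _ h0
        refine ⟨c - c' + (p : A) ^ (n - 1 - m) * d, ?_⟩
        rw [mul_add, ← mul_assoc, ← pow_add, show m + (n - 1 - m) = n - 1 by omega, ← hd]
        abel
      obtain ⟨t, a, hta⟩ := ih1 w' hcw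
      refine ⟨fun j => Nat.casesOn j s t, a, ?_⟩
      rw [Finset.sum_range_succ', sub_eq_iff_eq_add.mp hw', hta, mul_add, Finset.mul_sum]
      simp only [pow_zero, one_mul, tsub_zero, ← mul_assoc, ← pow_succ']
      rw [add_right_comm]
      refine congrArg₂ _ (congrArg₂ _ (Finset.sum_congr rfl fun j _ => ?_) rfl) rfl
      rw [Nat.sub_sub, add_comm 1 j]
    refine ⟨fun w hw => hdec w hw, fun w hw => ?_⟩
    obtain ⟨t, a, hta⟩ := hdec w fun b => by
      obtain ⟨c, hc⟩ := hw b
      exact ⟨p * c, by rw [hc, ← mul_assoc, ← pow_succ]⟩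
    obtain ⟨u, hu⟩ := hcartier m t fun s => by
      let B : Subring A := (Subring.center A₁).comap π
      have hB (b b' : A) (hb : b ∈ B) (hb' : b' ∈ B) :
          ∃ e ∈ B, b * b' - b' * b = (p : A) * e := by
        obtain ⟨x, hx⟩ := (hcen _).mp hb
        obtain ⟨y, hy⟩ := (hcen _).mp hb'
        obtain ⟨e, he, he'⟩ := hbr b b' x y hx hy
        exact ⟨e, (hcen _).mpr ⟨_, he'⟩, he.symm⟩
      have hterm (j : ℕ) : ∃ e, (p : A) ^ j * (l (t j) ^ p ^ (m - j) * l s -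
          l s * l (t j) ^ p ^ (m - j)) = (p : A) ^ (j + (m - j + 1)) * e ∧
          π e = i (t j ^ (p ^ (m - j) - 1) * br (t j) s) := by
        obtain ⟨e₀, he₀, he₀'⟩ := hbr (l (t j)) (l s) _ _ (hl _) (hl _)
        obtain ⟨f, -, hf⟩ := pow_prime_pow_mul_sub_mul hp B (hlc (t j))
          (fun b hb => hB _ b (hlc _) hb) (m - j) ((hcen _).mpr ⟨_, he₀'⟩) he₀.symm
        refine ⟨_, by rw [hf, ← mul_assoc, ← pow_add], ?_⟩
        rw [map_add, map_mul, map_mul, hπp, zero_mul, add_zero, he₀', map_pow, hl, mul_comm,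
          map_mul, map_pow]
      choose e he he' using hterm
      obtain ⟨g, hg⟩ : ∃ g, a * l s - l s * a = (p : A) * g :=
        (hker _).mp (by
          rw [map_sub, map_mul, map_mul, Subring.mem_center_iff.mp (hlc s), sub_self])
      obtain ⟨c, hc⟩ := hw (l s)
      have hz : (p : A) ^ (m + 1) *
          (∑ j ∈ Finset.range (m + 1), e j + p * g - p * c) = 0 := by
        rw [mul_sub, mul_add, ← mul_assoc _ _ c, ← pow_succ, ← hc, ← hg, hta, Finset.mul_sum]
        rw [Finset.sum_congr rfl fun j hj => show (p : A) ^ (m + 1) * e j =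
          (p : A) ^ j * (l (t j) ^ p ^ (m - j) * l s) -
            (p : A) ^ j * (l s * l (t j) ^ p ^ (m - j)) by
            rw [← mul_sub, he, show j + (m - j + 1) = m + 1 by
              rw [Finset.mem_range] at hj
              omega]]
        rw [Finset.sum_sub_distrib, add_mul, mul_add, Finset.sum_mul, Finset.mul_sum]
        simp only [hpc, mul_assoc, mul_sub]
        abel
      obtain ⟨d, hd⟩ := hflat (m + 1) (by omega) _ hz
      have := congrArg π hd
      rw [map_sub, map_add, map_mul, map_mul, map_mul, map_pow, hπp, zero_mul, zero_mul,
        zero_pow (by omega), zero_mul, add_zero, sub_zero, map_sum] at this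
      rw [Finset.sum_congr rfl fun j _ => he' j, ← map_sum] at this
      exact hi (this.trans (map_zero i).symm)
    refine ⟨u, ?_⟩
    rw [hta, Finset.sum_range_succ', map_add, map_add, map_sum]
    simp only [map_mul, map_pow, hπp, hl, zero_mul, pow_zero,
      one_mul, Finset.sum_const_zero, add_zero, zero_add, tsub_zero, ← hu, ← pow_mul, pow_succ']

end Center

/-- Let `A` be a deformation quantization over `W_n(k)` (`n ≥ 1`) of an Azumaya
algebra `A₁` over a smooth affine symplectic `k`-algebra `S = Z(A₁)`, with structural
surjection `π : A → A₁` having kernel `pA`. Then the image of the center of `A` under the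
composite `A → A/pA ≅ A₁` equals `S^{p^{n−1}} = {s^{p^{n−1}} : s ∈ S} ⊆ S = Z(A₁)`. -/
theorem stmt_9 (p : ℕ) [Fact p.Prime] (hp : 2 < p)
    (k : Type u) [Field k] [CharP k p] [ExpChar k p] [PerfectRing k p]
    (S : Type u) [CommRing S] [Algebra k S]
    (hfg : Algebra.FiniteType k S) [Algebra.FormallySmooth k S]
    (P : SymplecticPoisson k S)
    (A₁ : Type*) [Ring A₁] [Algebra k A₁] [Algebra S A₁] [IsScalarTower k S A₁]
    (hinj : Function.Injective (algebraMap S A₁))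
    (hcen : Set.range (algebraMap S A₁) = (Subring.center A₁ : Set A₁))
    (hAz : IsAzumayaOver S A₁)
    (n : ℕ) (hn : 0 < n)
    (A : Type*) [Ring A] [Algebra (TruncatedWittVector p n k) A]
    [Module.Flat (TruncatedWittVector p n k) A]
    (π : A →+* A₁) (hsurj : Function.Surjective π)
    (hker : ∀ a : A, π a = 0 ↔ ∃ b : A, a = (p : A) * b)
    (hcompat : ∀ w : TruncatedWittVector p n k,
      π (algebraMap (TruncatedWittVector p n k) A w) =
        algebraMap k A₁ (TruncatedWittVector.coeff ⟨0, hn⟩ w))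
    (hbr : ∀ (a b : A) (s t : S), π a = algebraMap S A₁ s → π b = algebraMap S A₁ t →
      ∃ c : A, (p : A) * c = a * b - b * a ∧ π c = algebraMap S A₁ (P.bracket s t)) :
    π '' (Subring.center A : Set A) =
      {x : A₁ | ∃ s : S, x = algebraMap S A₁ (s ^ p ^ (n - 1))} := by
  have : Algebra.FinitePresentation k S := Algebra.FinitePresentation.of_finiteType.mp hfg
  have : Algebra.Smooth k S := {}
  have hcen' (x : A₁) : x ∈ Subring.center A₁ ↔ ∃ s, x = algebraMap S A₁ s := by
    rw [← SetLike.mem_coe, ← hcen]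
    exact ⟨fun ⟨s, hs⟩ => ⟨s, hs.symm⟩, fun ⟨s, hs⟩ => ⟨s, hs.symm⟩⟩
  have hpn : (p : A) ^ n = 0 := by
    rw [← map_natCast (algebraMap (TruncatedWittVector p n k) A), ← map_pow,
      TruncatedWittVector.natCast_pow_eq_zero, map_zero]
  choose l hl using fun s : S => hsurj (algebraMap S A₁ s)
  ext x
  constructor
  · rintro ⟨w, hw, rfl⟩
    refine (IsCentralModPow.exists_map_eq_and_exists_eq_sum hp hinj hcen' P.bracket
      (fun m t h => P.exists_pow_eq_of_sum_eq_zero p m t h)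
      (Module.Flat.eq_pow_mul_of_pow_mul_eq_zero
        (TruncatedWittVector.eq_pow_mul_of_mul_eq_zero p n k))
      π hsurj hker hbr l hl (n - 1) (by omega)).2 w fun b => ⟨0, ?_⟩
    rw [mul_zero, sub_eq_zero]
    exact (Subring.mem_center_iff.mp hw b).symm
  · rintro ⟨s, rfl⟩
    refine ⟨l s ^ p ^ (n - 1), Subring.mem_center_iff.mpr fun b => ?_, by rw [map_pow, hl, map_pow]⟩
    obtain ⟨c, hc⟩ := IsCentralModPow.pow_of_map_mem_center hp π (fun a => (hker a).mp)
      (a := l s) ((hcen' _).mpr ⟨s, hl s⟩) (n - 1) b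
    rw [Nat.sub_add_cancel hn, hpn, zero_mul, sub_eq_zero] at hc
    exact hc.symm
end

section
/- Let S be a commutative k-algebra that is essentially of finite type over k and formally smooth over k. Let I be an ideal of S such that d x ∈ I·Ω¹_{S/k} for every x ∈ I. Then I = (I ∩ S^p)·S, i.e., I is generated as an ideal by the p-th powers it contains. -/
open KaehlerDifferential in
/-- The property `d I ⊆ I·Ω` of an ideal `I` passes to its extensions. -/
theorem Ideal.D_mem_smul_top_of_mem_map {k S T : Type*} [CommRing k] [CommRing S] [CommRing T]
    [Algebra k S] [Algebra k T] [Algebra S T] [IsScalarTower k S T] {I : Ideal S}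
    (hI : ∀ x ∈ I, D k S x ∈ I • (⊤ : Submodule S (Ω[S⁄k])))
    {y : T} (hy : y ∈ I.map (algebraMap S T)) :
    D k T y ∈ I.map (algebraMap S T) • (⊤ : Submodule T (Ω[T⁄k])) := by
  have hmap : ∀ w ∈ I • (⊤ : Submodule S (Ω[S⁄k])),
      KaehlerDifferential.map k k S T w ∈
        I.map (algebraMap S T) • (⊤ : Submodule T (Ω[T⁄k])) := by
    intro w hw
    refine Submodule.smul_induction_on hw (fun r hr n _ => ?_) (fun u v hu hv => ?_)
    · rw [map_smul, ← algebraMap_smul T r]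
      exact Submodule.smul_mem_smul (Ideal.mem_map_of_mem _ hr) trivial
    · rw [map_add]
      exact add_mem hu hv
  refine Submodule.span_induction ?_ ?_ ?_ ?_ hy
  · rintro _ ⟨x, hx, rfl⟩
    rw [← KaehlerDifferential.map_D k k S T]
    exact hmap _ (hI x hx)
  · simp
  · intro u v _ _ hu hv
    rw [map_add]
    exact add_mem hu hv
  · intro a x hx h
    rw [smul_eq_mul, Derivation.leibniz]
    exact add_mem (Submodule.smul_mem _ _ h) (Submodule.smul_mem_smul hx trivial)

theorem Module.Finite.of_essFiniteType_of_pow_mem {A S : Type*} [CommRing A] [CommRing S]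
    [Algebra A S] [Algebra.EssFiniteType A S] {n : ℕ} (hn : 0 < n)
    (h : ∀ s : S, s ^ n ∈ (algebraMap A S).range) : Module.Finite A S := by
  obtain ⟨σ, hσ⟩ := (Algebra.essFiniteType_iff A S).mp inferInstance
  have hint : ∀ s : S, IsIntegral A s := fun s => by
    obtain ⟨a, ha⟩ := h s
    exact IsIntegral.of_pow hn (ha ▸ isIntegral_algebraMap)
  have htop : Algebra.adjoin A (σ : Set S) = ⊤ := by
    rw [eq_top_iff]
    intro s _
    obtain ⟨t, ht, ⟨u, rfl⟩, hst⟩ := hσ s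
    obtain ⟨a, ha⟩ := h (u⁻¹ : Sˣ)
    have e : s = (s * u) * (u : S) ^ (n - 1) * ((u⁻¹ : Sˣ) : S) ^ n := by
      rw [mul_assoc s, ← pow_succ', Nat.sub_add_cancel hn, mul_assoc, ← mul_pow]
      simp
    rw [e, ← ha]
    exact mul_mem (mul_mem hst (pow_mem ht _)) (Subalgebra.algebraMap_mem _ _)
  have := fg_adjoin_of_finite (R := A) σ.finite_toSet (fun x _ => hint x)
  rw [htop] at this
  exact ⟨by simpa using this⟩

open TensorProduct in
/-- A finite unramified extension in characteristic `p` that contains all `p`-th powers is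
trivial. -/
theorem Algebra.FormallyUnramified.surjective_of_pow_mem {A S : Type*} [CommRing A] [CommRing S]
    [Algebra A S] [Module.Finite A S] [Algebra.FormallyUnramified A S] {p : ℕ} (hp : p.Prime)
    (hpS : (p : S) = 0) (h : ∀ s : S, s ^ p ∈ (algebraMap A S).range) :
    Function.Surjective (algebraMap A S) := by
  rw [← Algebra.isEpi_iff_surjective_algebraMap_of_finite, Algebra.isEpi_iff_forall_one_tmul_eq]
  intro s
  obtain ⟨e, he, hsp⟩ : ∃ e, IsIdempotentElem e ∧
      KaehlerDifferential.ideal A S = Ideal.span {e} :=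
    (Ideal.isIdempotentElem_iff_of_fg _ (KaehlerDifferential.ideal_fg A S)).mp <|
      (Ideal.cotangent_subsingleton_iff _).mp <| inferInstanceAs <| Subsingleton (Ω[S⁄A])
  have hpT : (p : S ⊗[A] S) = 0 := by
    rw [← map_natCast (algebraMap S (S ⊗[A] S)), hpS, map_zero]
  have hnil : KaehlerDifferential.ideal A S ≤ nilradical (S ⊗[A] S) := by
    rw [← KaehlerDifferential.span_range_eq_ideal, Ideal.span_le]
    rintro _ ⟨s, rfl⟩
    refine ⟨p, ?_⟩
    obtain ⟨r, hr⟩ := exists_add_pow_prime_eq hp ((1 : S) ⊗ₜ[A] s - s ⊗ₜ[A] (1 : S))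
      (s ⊗ₜ[A] (1 : S))
    obtain ⟨a, ha⟩ := h s
    have hs : (1 : S) ⊗ₜ[A] (s ^ p) = (s ^ p) ⊗ₜ[A] (1 : S) := by
      rw [← ha, Algebra.algebraMap_eq_smul_one, TensorProduct.smul_tmul]
    rw [sub_add_cancel, Algebra.TensorProduct.tmul_pow, Algebra.TensorProduct.tmul_pow,
      one_pow, hpT, hs] at hr
    simpa using hr
  have he0 : e = 0 := by
    obtain ⟨n, hn⟩ : IsNilpotent e := hnil (hsp ▸ Ideal.mem_span_singleton_self e)
    rw [← he.pow_succ_eq n, pow_succ, hn, zero_mul]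
  have := KaehlerDifferential.one_smul_sub_smul_one_mem_ideal A s
  rw [hsp, he0] at this
  simpa [sub_eq_zero] using this

/-- If an ideal is stable under a derivation `∂` with `∂ x = 1`, then it contains the coefficients
of every polynomial expression in `x` of degree `< p` with `∂`-constant coefficients which it
contains. -/
theorem Derivation.coeff_mem_of_sum_mem {k S : Type*} [Field k] [CommRing S] [Algebra k S]
    (p : ℕ) [CharP k p] {I : Ideal S} (d : Derivation k S S)
    (hI : ∀ f ∈ I, d f ∈ I) {x : S} (hx : d x = 1) {n : ℕ} (hn : n ≤ p) (c : ℕ → S)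
    (hc : ∀ i, d (c i) = 0) (hsum : ∑ i ∈ Finset.range n, c i * x ^ i ∈ I) :
    ∀ i < n, c i ∈ I := by
  induction n generalizing c with
  | zero => simp
  | succ n ih =>
    have hsucc : ∀ i < n, c (i + 1) ∈ I := by
      intro i hi
      have key := ih (by omega) (fun i => algebraMap k S ((i + 1 : ℕ) : k) * c (i + 1))
        (fun i => by simp [hc]) (by
          have h := hI _ hsum
          rw [map_sum, Finset.sum_range_succ'] at h
          convert h using 1
          rw [← add_zero (Finset.sum _ _)]
          congr 1
          · refine Finset.sum_congr rfl fun i _ => ?_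
            rw [Derivation.leibniz, hc, Derivation.leibniz_pow, hx]
            simp
            ring
          · simp [hc]) i hi
      have hne : ((i + 1 : ℕ) : k) ≠ 0 := by
        rw [Ne, CharP.cast_eq_zero_iff k p]
        exact fun hd => absurd (Nat.le_of_dvd (by omega) hd) (by omega)
      have := I.mul_mem_left (algebraMap k S ((i + 1 : ℕ) : k)⁻¹) key
      rwa [← mul_assoc, ← map_mul, inv_mul_cancel₀ hne, map_one, one_mul] at this
    intro i hi
    cases i with
    | succ i => exact hsucc i (by omega)
    | zero =>
      rw [Finset.sum_range_succ'] at hsum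
      have := (I.add_mem_iff_right (I.sum_mem fun i hi =>
        I.mul_mem_right _ (hsucc i (Finset.mem_range.mp hi)))).mp hsum
      simpa using this

/-- If `x ^ n ∈ C`, then every element of `C[x]` is a polynomial in `x` of degree `< n`. -/
theorem Algebra.exists_sum_of_mem_adjoin_singleton {C S : Type*} [CommRing C] [CommRing S]
    [Algebra C S] {x : S} {n : ℕ} (hn : 0 < n) (hx : x ^ n ∈ (algebraMap C S).range) {f : S}
    (hf : f ∈ Algebra.adjoin C {x}) :
    ∃ c : ℕ → C, f = ∑ i ∈ Finset.range n, algebraMap C S (c i) * x ^ i := by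
  cases subsingleton_or_nontrivial S
  · exact ⟨0, Subsingleton.elim _ _⟩
  have : Nontrivial C := (algebraMap C S).domain_nontrivial
  obtain ⟨a, ha⟩ := hx
  rw [Algebra.adjoin_singleton_eq_range_aeval] at hf
  obtain ⟨q, rfl⟩ := hf
  have hmonic : (Polynomial.X ^ n - Polynomial.C a).Monic :=
    Polynomial.monic_X_pow_sub_C a hn.ne'
  have hdeg : (q %ₘ (Polynomial.X ^ n - Polynomial.C a)).natDegree < n := by
    have := Polynomial.natDegree_modByMonic_lt q hmonic (fun h => by
      have := congrArg Polynomial.natDegree h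
      rw [Polynomial.natDegree_X_pow_sub_C, Polynomial.natDegree_one] at this
      omega)
    rwa [Polynomial.natDegree_X_pow_sub_C] at this
  refine ⟨(q %ₘ (Polynomial.X ^ n - Polynomial.C a)).coeff, ?_⟩
  have h := Polynomial.aeval_modByMonic_eq_self_of_root (p := q)
    (q := Polynomial.X ^ n - Polynomial.C a) (x := x) (by simp [ha])
  change Polynomial.aeval x q = _
  rw [← h, Polynomial.aeval_eq_sum_range' hdeg]
  simp [Algebra.smul_def]

/-- The subalgebra generated by all `n`-th powers and the `x i` with `i ∈ T`. -/
def Algebra.adjoinPows (k : Type*) {S ι : Type*} [CommRing k] [CommRing S] [Algebra k S] (n : ℕ)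
    (x : ι → S) (T : Set ι) : Subalgebra k S :=
  Algebra.adjoin k ({s : S | ∃ t : S, s = t ^ n} ∪ x '' T)

theorem Algebra.pow_mem_adjoinPows (k : Type*) {S ι : Type*} [CommRing k] [CommRing S]
    [Algebra k S] (n : ℕ) (x : ι → S) (T : Set ι) (s : S) : s ^ n ∈ adjoinPows k n x T :=
  Algebra.subset_adjoin (Or.inl ⟨s, rfl⟩)

theorem Algebra.adjoinPows_empty (k : Type*) {S ι : Type*} [CommRing k] [CommRing S]
    [Algebra k S] (p : ℕ) [ExpChar k p] [ExpChar S p] [PerfectRing k p] (x : ι → S) {f : S}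
    (hf : f ∈ adjoinPows k p x ∅) : ∃ t : S, f = t ^ p := by
  rw [adjoinPows, Set.image_empty, Set.union_empty] at hf
  induction hf using Algebra.adjoin_induction with
  | mem x hx => exact hx
  | algebraMap r =>
    obtain ⟨s, rfl⟩ := (bijective_frobenius k p).surjective r
    exact ⟨algebraMap k S s, by simp [frobenius_def]⟩
  | add a b _ _ ha hb =>
    obtain ⟨⟨s, rfl⟩, ⟨t, rfl⟩⟩ := ha, hb
    exact ⟨s + t, (add_pow_expChar s t p).symm⟩
  | mul a b _ _ ha hb =>
    obtain ⟨⟨s, rfl⟩, ⟨t, rfl⟩⟩ := ha, hb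
    exact ⟨s * t, (mul_pow s t p).symm⟩

theorem Algebra.adjoinPows_insert (k : Type*) {S ι : Type*} [CommRing k] [CommRing S]
    [Algebra k S] (n : ℕ) (x : ι → S) (i : ι) (T : Set ι) :
    adjoinPows k n x (insert i T) =
      (Algebra.adjoin (adjoinPows k n x T) {x i}).restrictScalars k := by
  rw [adjoinPows, adjoinPows, ← Algebra.adjoin_union_eq_adjoin_adjoin, Set.image_insert_eq,
    ← Set.union_singleton, Set.union_assoc]

/-- If `S` is generated over its `p`-th powers by finitely many elements admitting dual
derivations which preserve the ideal `I`, then `I` is generated by `p`-th powers. -/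
theorem Ideal.le_span_pow_of_dual_derivations {k S ι : Type*} [Field k] [CommRing S] [Algebra k S]
    (p : ℕ) [Fact p.Prime] [CharP k p] [ExpChar k p] [CharP S p] [PerfectRing k p] (I : Ideal S)
    [Finite ι] (x : ι → S) (d : ι → Derivation k S S) (hself : ∀ i, d i (x i) = 1)
    (hne : ∀ i j, i ≠ j → d i (x j) = 0) (hI : ∀ i, ∀ f ∈ I, d i f ∈ I)
    (htop : Algebra.adjoinPows k p x Set.univ = ⊤) :
    I ≤ Ideal.span ((I : Set S) ∩ {s : S | ∃ t : S, s = t ^ p}) := by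
  have hp : p.Prime := Fact.out
  have : ExpChar S p := .prime hp
  suffices H : ∀ T : Set ι, T.Finite → ∀ f ∈ I, f ∈ Algebra.adjoinPows k p x T →
      f ∈ Ideal.span ((I : Set S) ∩ {s : S | ∃ t : S, s = t ^ p}) from
    fun f hf => H Set.univ Set.finite_univ f hf (htop ▸ trivial)
  intro T hT
  induction T, hT using Set.Finite.induction_on with
  | empty =>
    intro f hf hfT
    exact Ideal.subset_span ⟨hf, Algebra.adjoinPows_empty k p x hfT⟩
  | @insert i T hi _ ih =>
    intro f hf hfT
    rw [Algebra.adjoinPows_insert, Subalgebra.mem_restrictScalars] at hfT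
    obtain ⟨c, rfl⟩ := Algebra.exists_sum_of_mem_adjoin_singleton hp.pos
      ⟨⟨_, Algebra.pow_mem_adjoinPows k p x T (x i)⟩, rfl⟩ hfT
    have hconst : ∀ g ∈ Algebra.adjoinPows k p x T, d i g = 0 := by
      intro g hg
      rw [Algebra.adjoinPows] at hg
      induction hg using Algebra.adjoin_induction with
      | mem g hg =>
        rcases hg with ⟨t, rfl⟩ | ⟨j, hj, rfl⟩
        · simp [Derivation.leibniz_pow]
        · exact hne i j (fun h => hi (h ▸ hj))
      | algebraMap r => simp
      | add a b _ _ ha hb => simp [ha, hb]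
      | mul a b _ _ ha hb => simp [ha, hb]
    have hcI := (d i).coeff_mem_of_sum_mem p (hI i) (hself i) le_rfl (fun j => (c j : S))
      (fun j => hconst _ (c j).2) hf
    refine Ideal.sum_mem _ fun j hj => Ideal.mul_mem_right _ _ ?_
    exact ih _ (hcI j (Finset.mem_range.mp hj)) (c j).2

open KaehlerDifferential in
/-- Elements whose differentials generate `Ω` generate `S` over its `p`-th powers. -/
theorem Algebra.adjoinPows_univ_eq_top {k S ι : Type*} [Field k] [CommRing S] [Algebra k S]
    [Algebra.EssFiniteType k S] {p : ℕ} (hp : p.Prime) [CharP S p] (x : ι → S)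
    (hx : Submodule.span S (Set.range fun i => D k S (x i)) = ⊤) :
    adjoinPows k p x Set.univ = ⊤ := by
  set A := adjoinPows k p x Set.univ
  have hpow : ∀ s : S, s ^ p ∈ (algebraMap A S).range := fun s =>
    ⟨⟨_, pow_mem_adjoinPows k p x Set.univ s⟩, rfl⟩
  have : Algebra.EssFiniteType A S := .of_comp k A S
  have : Module.Finite A S := .of_essFiniteType_of_pow_mem hp.pos hpow
  have hzero : KaehlerDifferential.map k A S S = 0 := by
    refine LinearMap.ext_on_range hx fun i => ?_
    rw [KaehlerDifferential.map_D]
    exact (D A S).map_algebraMap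
      ⟨x i, Algebra.subset_adjoin (Or.inr ⟨i, trivial, rfl⟩)⟩
  have : Algebra.FormallyUnramified A S := by
    refine ⟨subsingleton_of_forall_eq 0 fun w => ?_⟩
    obtain ⟨v, rfl⟩ := KaehlerDifferential.map_surjective k A S w
    rw [hzero, LinearMap.zero_apply]
  rw [Algebra.eq_top_iff]
  intro s
  obtain ⟨a, rfl⟩ := Algebra.FormallyUnramified.surjective_of_pow_mem hp
    (CharP.cast_eq_zero S p) hpow s
  exact a.2

theorem Ideal.apply_mem_of_mem_smul_top {S M : Type*} [CommRing S] [AddCommGroup M] [Module S M]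
    {I : Ideal S} (φ : M →ₗ[S] S) {w : M} (hw : w ∈ I • (⊤ : Submodule S M)) : φ w ∈ I := by
  refine Submodule.smul_induction_on hw (fun r hr n _ => ?_) (fun u v hu hv => ?_)
  · rw [map_smul, smul_eq_mul]
    exact I.mul_mem_right _ hr
  · rw [map_add]
    exact add_mem hu hv

open KaehlerDifferential in
theorem Ideal.le_span_pow_of_isLocalRing (p : ℕ) [Fact p.Prime]
    (k : Type*) [Field k] [CharP k p] [ExpChar k p] [PerfectRing k p]
    (S : Type*) [CommRing S] [IsLocalRing S] [Algebra k S]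
    [Algebra.EssFiniteType k S] [Algebra.FormallySmooth k S] (I : Ideal S)
    (hI : ∀ x ∈ I, D k S x ∈ I • (⊤ : Submodule S (Ω[S⁄k]))) :
    I ≤ Ideal.span ((I : Set S) ∩ {s : S | ∃ t : S, s = t ^ p}) := by
  have : CharP S p := charP_of_injective_algebraMap (algebraMap k S).injective p
  have : Module.Projective S (Ω[S⁄k]) := Algebra.FormallySmooth.projective_kaehlerDifferential
  obtain ⟨κ, x, b, hb⟩ := Module.exists_basis_of_span_of_flat (D k S) (span_range_derivation k S)
  have : Finite κ := Module.Finite.finite_basis b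
  refine I.le_span_pow_of_dual_derivations p x (fun i => (b.coord i).compDer (D k S))
    (fun i => ?_) (fun i j hij => ?_) (fun i f hf => ?_)
    (Algebra.adjoinPows_univ_eq_top Fact.out x ?_)
  · change b.coord i (D k S (x i)) = 1
    simp [← hb]
  · change b.coord i (D k S (x j)) = 0
    simp [← hb, hij.symm]
  · change b.coord i (D k S f) ∈ I
    exact Ideal.apply_mem_of_mem_smul_top (b.coord i) (hI f hf)
  · rw [← b.span_eq]
    congr 2
    ext i
    exact (hb i).symm

/-- Let `k` be a perfect field of characteristic `p > 2` and `S` a commutative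
`k`-algebra, essentially of finite type and formally smooth over `k`. If `I` is an ideal of `S`
with `d x ∈ I·Ω¹_{S/k}` for all `x ∈ I`, then `I` is generated by the `p`-th powers it
contains: `I = (I ∩ Sᵖ)·S`. -/
theorem stmt_10 (p : ℕ) [Fact p.Prime] (hp : 2 < p)
    (k : Type u) [Field k] [CharP k p] [ExpChar k p] [PerfectRing k p]
    (S : Type u) [CommRing S] [Algebra k S]
    [Algebra.EssFiniteType k S] [Algebra.FormallySmooth k S]
    (I : Ideal S)
    (hdI : ∀ x ∈ I, KaehlerDifferential.D k S x ∈
      I • (⊤ : Submodule S (KaehlerDifferential k S))) :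
    I = Ideal.span ((I : Set S) ∩ {s : S | ∃ t : S, s = t ^ p}) := by
  refine le_antisymm (Ideal.le_of_localization_maximal fun P hP => ?_)
    (Ideal.span_le.mpr Set.inter_subset_left)
  let T := Localization.AtPrime P
  have : Algebra.FormallySmooth S T := .of_isLocalization P.primeCompl
  have : Algebra.FormallySmooth k T := .comp k S T
  have : Algebra.EssFiniteType S T := .of_isLocalization T P.primeCompl
  have : Algebra.EssFiniteType k T := .comp k S T
  refine (Ideal.le_span_pow_of_isLocalRing p k T (I.map (algebraMap S T))
    fun y hy => Ideal.D_mem_smul_top_of_mem_map hdI hy).trans (Ideal.span_le.mpr ?_)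
  rintro _ ⟨hy, t, rfl⟩
  obtain ⟨u, s, rfl⟩ := IsLocalization.exists_mk'_eq P.primeCompl t
  rw [← IsLocalization.mk'_pow, SetLike.mem_coe,
    IsLocalization.mk'_mem_map_algebraMap_iff] at hy
  obtain ⟨r, hr, hru⟩ := hy
  have hmem : (r * u) ^ p ∈ Ideal.span ((I : Set S) ∩ {s : S | ∃ t : S, s = t ^ p}) := by
    refine Ideal.subset_span ⟨?_, r * u, rfl⟩
    rw [mul_pow, ← Nat.sub_add_cancel (Fact.out : p.Prime).one_le, pow_succ r, mul_assoc,
      Nat.sub_add_cancel (Fact.out : p.Prime).one_le]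
    exact I.mul_mem_left _ hru
  rw [← IsLocalization.mk'_pow, SetLike.mem_coe, IsLocalization.mk'_mem_map_algebraMap_iff]
  exact ⟨r ^ p, pow_mem hr p, by rwa [← mul_pow]⟩
end

section
/- Let m be an ideal of S and let x ∈ S satisfy d x ∈ m^{[p]}·Ω¹_{S/k}. Then x ∈ S^p + m^{[p]}, i.e., x = a^p + b for some a ∈ S and some b in the ideal of S generated by p-th powers of elements of m. -/
section PolynomialDerivation

open Polynomial

section OneVariable

variable {k S : Type*} [Field k] [CommRing S] [Algebra k S]

theorem natCast_mul_mem_iff (p : ℕ) [Fact p.Prime] [CharP k p] (J : Ideal S) {j : ℕ} (hj : 0 < j)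
    (hjp : j < p) {y : S} : (j : S) * y ∈ J ↔ y ∈ J := by
  have hj0 : (j : k) ≠ 0 := fun h =>
    Nat.not_dvd_of_pos_of_lt hj hjp ((CharP.cast_eq_zero_iff k p j).mp h)
  have hu : IsUnit (j : S) := by
    simpa using (IsUnit.mk0 _ hj0).map (algebraMap k S)
  exact J.unit_mul_mem_iff_mem hu

theorem aeval_sub_coeff_zero_mem {C : Subalgebra k S} {t : S} {J : Ideal S} {f : C[X]}
    (hf : ∀ j, (f.coeff (j + 1) : S) ∈ J) : aeval t f - (f.coeff 0 : S) ∈ J := by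
  have h : aeval t f - (f.coeff 0 : S) = aeval t f.divX * t := by
    conv_lhs => enter [1]; rw [← f.divX_mul_X_add]
    simp
  rw [h, aeval_eq_sum_range]
  refine J.mul_mem_right _ (J.sum_mem fun j _ => ?_)
  rw [coeff_divX, Algebra.smul_def]
  exact J.mul_mem_right _ (hf j)

theorem coeff_succ_mem_of_derivative (p : ℕ) [Fact p.Prime] [CharP k p] {C : Subalgebra k S}
    {J : Ideal S} {f : C[X]} (hfp : f.degree < p)
    (hf : ∀ j, ((derivative f).coeff j : S) ∈ J) (j : ℕ) : (f.coeff (j + 1) : S) ∈ J := by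
  by_cases hj : j + 1 < p
  · have h := hf j
    rw [coeff_derivative] at h
    rw [← natCast_mul_mem_iff (k := k) p J j.succ_pos hj]
    simpa [mul_comm] using h
  · rw [coeff_eq_zero_of_degree_lt (hfp.trans_le (by exact_mod_cast not_lt.mp hj))]
    exact J.zero_mem

theorem derivation_aeval (δ : Derivation k S S) {C : Subalgebra k S} (hC : ∀ c ∈ C, δ c = 0)
    {t : S} (ht : δ t = 1) (f : C[X]) : δ (aeval t f) = aeval t (derivative f) := by
  induction f using Polynomial.induction_on' with
  | add f g hf hg => simp [hf, hg]
  | monomial j c =>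
    simp [aeval_monomial, derivative_monomial, Derivation.leibniz, Derivation.leibniz_pow, ht,
      hC c.1 c.2, mul_assoc]

theorem coeff_mem_of_aeval_mem (δ : Derivation k S S) {C : Subalgebra k S}
    (hC : ∀ c ∈ C, δ c = 0) {t : S} (ht : δ t = 1) {J : Ideal S} (hJ : ∀ y ∈ J, δ y ∈ J)
    (p : ℕ) [Fact p.Prime] [CharP k p] (n : ℕ) (hn : n ≤ p)
    (f : C[X]) (hfn : f.degree < n) (hf : aeval t f ∈ J) (j : ℕ) : (f.coeff j : S) ∈ J := by
  induction n generalizing f j with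
  | zero =>
    have : f = 0 := by simpa using hfn
    simp [this]
  | succ n ih =>
    have hd : (derivative f).degree < n := by
      rw [degree_lt_iff_coeff_zero] at hfn ⊢
      intro i hi
      rw [coeff_derivative, hfn (i + 1) (by omega), zero_mul]
    have hs := coeff_succ_mem_of_derivative p (hfn.trans_le (by exact_mod_cast hn))
      (ih (by omega) _ hd (by rw [← derivation_aeval δ hC ht]; exact hJ _ hf))
    cases j with
    | zero => simpa using J.sub_mem hf (aeval_sub_coeff_zero_mem (t := t) hs)
    | succ j => exact hs j

theorem exists_sub_mem_of_derivation_mem (δ : Derivation k S S) {C : Subalgebra k S}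
    (hC : ∀ c ∈ C, δ c = 0) {t : S} (ht : δ t = 1) {J : Ideal S} (hJ : ∀ y ∈ J, δ y ∈ J)
    (p : ℕ) [Fact p.Prime] [CharP k p] (htp : t ^ p ∈ C)
    {z : S} (f : C[X]) (hz : z - aeval t f ∈ J) (hδ : δ z ∈ J) : ∃ c ∈ C, z - c ∈ J := by
  have hp : p ≠ 0 := (Fact.out : p.Prime).ne_zero
  have hmonic := monic_X_pow_sub_C (⟨t ^ p, htp⟩ : C) hp
  nontriviality S
  set g := f %ₘ (X ^ p - Polynomial.C ⟨t ^ p, htp⟩) with hg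
  have hgf : aeval t g = aeval t f := by
    have := congrArg (aeval t) (modByMonic_add_div f (X ^ p - Polynomial.C (⟨t ^ p, htp⟩ : C)))
    simpa [Subalgebra.algebraMap_def] using this
  have hdeg : g.degree < p := by
    simpa [degree_X_pow_sub_C (Nat.pos_of_ne_zero hp)] using degree_modByMonic_lt f hmonic
  have hder : aeval t (derivative g) ∈ J := by
    rw [← derivation_aeval δ hC ht, hgf]
    simpa using J.sub_mem hδ (hJ _ hz)
  have hs := coeff_succ_mem_of_derivative p hdeg (coeff_mem_of_aeval_mem δ hC ht hJ p p le_rfl _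
    ((degree_derivative_le).trans_lt hdeg) hder)
  refine ⟨_, (g.coeff 0).2, ?_⟩
  have := J.add_mem hz (aeval_sub_coeff_zero_mem (t := t) hs)
  rw [hgf] at this
  simpa using this

end OneVariable

/-- A finite type algebra which is unramified over a subalgebra containing all `p`-th powers
equals that subalgebra. -/
theorem Subalgebra.eq_top_of_formallyUnramified_s11 {k S : Type*} [Field k] [CommRing S] [Algebra k S]
    [Algebra.FiniteType k S] (p : ℕ) [Fact p.Prime] [CharP k p] (B : Subalgebra k S)
    (hB : ∀ s : S, s ^ p ∈ B) [Algebra.FormallyUnramified B S] : B = ⊤ := by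
  have hp : p.Prime := Fact.out
  have hft : Algebra.FiniteType B S := .of_restrictScalars_finiteType k B S
  have hint : Algebra.IsIntegral B S := ⟨fun s =>
    IsIntegral.of_pow hp.pos (x := s) (isIntegral_algebraMap (x := (⟨s ^ p, hB s⟩ : B)))⟩
  have hfin : Module.Finite B S := Algebra.IsIntegral.finite
  have hnil : IsNilpotent (KaehlerDifferential.ideal B S) := by
    rw [Ideal.FG.isNilpotent_iff_le_nilradical (KaehlerDifferential.ideal_fg B S),
      ← KaehlerDifferential.span_range_eq_ideal, Ideal.span_le]
    rintro _ ⟨s, rfl⟩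
    refine ⟨p, ?_⟩
    nontriviality (TensorProduct B S S)
    have : CharP (TensorProduct B S S) p :=
      charP_of_injective_algebraMap (algebraMap k (TensorProduct B S S)).injective p
    dsimp only
    rw [sub_pow_char, Algebra.TensorProduct.tmul_pow, Algebra.TensorProduct.tmul_pow, one_pow]
    refine sub_eq_zero.mpr ?_
    have h : s ^ p = (⟨s ^ p, hB s⟩ : B) • (1 : S) := by
      simp [Algebra.smul_def]
    rw [h, TensorProduct.tmul_smul, TensorProduct.smul_tmul']
  have hepi : Algebra.IsEpi B S := by
    rw [Algebra.isEpi_iff_forall_one_tmul_eq]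
    intro a
    have := Algebra.FormallyUnramified.ext (R := B) (A := S) (B := TensorProduct B S S) _ hnil
      (g₁ := Algebra.TensorProduct.includeRight) (g₂ := Algebra.TensorProduct.includeLeft) ?_
    · exact DFunLike.congr_fun this a
    · intro x
      rw [Ideal.Quotient.eq]
      exact KaehlerDifferential.one_smul_sub_smul_one_mem_ideal B x
  have := (Algebra.isEpi_iff_surjective_algebraMap_of_finite (R := B) (A := S)).mp hepi
  refine eq_top_iff.mpr fun s _ => ?_
  obtain ⟨b, rfl⟩ := this s
  exact b.2

open KaehlerDifferential in
theorem adjoin_pow_eq_top {k S ι : Type*} [Field k] [CommRing S] [Algebra k S]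
    [Algebra.FiniteType k S] (p : ℕ) [Fact p.Prime] [CharP k p] (x : ι → S)
    (hx : Submodule.span S (Set.range fun i => D k S (x i)) = ⊤) :
    Algebra.adjoin k (Set.range (fun s : S => s ^ p) ∪ Set.range x) = ⊤ := by
  set B := Algebra.adjoin k (Set.range (fun s : S => s ^ p) ∪ Set.range x) with hBdef
  have : Algebra.FormallyUnramified B S := by
    refine ⟨?_⟩
    have hsurj := KaehlerDifferential.map_surjective k B S
    have h0 : KaehlerDifferential.map k B S S = 0 := by
      refine LinearMap.ext_on_range hx fun i => ?_
      have hi : x i ∈ B := Algebra.subset_adjoin (Or.inr ⟨i, rfl⟩)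
      simpa using (D B S).map_algebraMap ⟨x i, hi⟩
    refine subsingleton_of_forall_eq 0 fun y => ?_
    obtain ⟨w, rfl⟩ := hsurj y
    simp [h0]
  exact Subalgebra.eq_top_of_formallyUnramified_s11 p B fun s => Algebra.subset_adjoin (Or.inl ⟨s, rfl⟩)

open KaehlerDifferential in
/-- If the `dxᵢ` form a basis of `Ω[S⁄k]` and `J` is stable under derivations, an element all of
whose derivatives lie in `J` is a `p`-th power modulo `J`. -/
theorem exists_sub_pow_mem_of_basis {k S ι : Type*} [Field k] [CommRing S] [Algebra k S]
    [Algebra.FiniteType k S] (p : ℕ) [Fact p.Prime] [CharP k p] [PerfectRing k p]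
    (b : Module.Basis ι S (Ω[S⁄k])) (x : ι → S) (hx : ∀ i, b i = D k S (x i))
    (J : Ideal S) (hJ : ∀ δ : Derivation k S S, ∀ y ∈ J, δ y ∈ J)
    (z : S) (hz : ∀ δ : Derivation k S S, δ z ∈ J) : ∃ a : S, z - a ^ p ∈ J := by
  classical
  nontriviality S
  have : CharP S p := charP_of_injective_algebraMap (algebraMap k S).injective p
  have hι : Finite ι := Module.Finite.finite_basis b
  let δ (i : ι) : Derivation k S S := (b.coord i).compDer (D k S)
  have hδ (i j : ι) : δ i (x j) = if j = i then 1 else 0 := by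
    simp [δ, ← hx, Finsupp.single_apply]
  let C (s : Set ι) : Subalgebra k S := Algebra.adjoin k (Set.range (fun s : S => s ^ p) ∪ x '' s)
  have hpow (s : Set ι) (y : S) : y ^ p ∈ C s := Algebra.subset_adjoin (Or.inl ⟨y, rfl⟩)
  have hδC (s : Set ι) (i : ι) (hi : i ∉ s) (c : S) (hc : c ∈ C s) : δ i c = 0 := by
    have : Set.EqOn (δ i) (0 : Derivation k S S)
        (Set.range (fun s : S => s ^ p) ∪ x '' s) := by
      rintro _ (⟨y, rfl⟩ | ⟨j, hj, rfl⟩)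
      · simp [Derivation.leibniz_pow]
      · have : j ≠ i := by rintro rfl; exact hi hj
        simp [hδ, this]
    exact Derivation.eqOn_adjoin this hc
  have key (s : Set ι) (hs : s.Finite) : (∃ c ∈ C s, z - c ∈ J) → ∃ c ∈ C ∅, z - c ∈ J := by
    induction s, hs using Set.Finite.induction_on with
    | empty => exact id
    | @insert i s hi _ ih =>
      rintro ⟨c, hc, hzc⟩
      refine ih ?_
      have hle : C (insert i s) ≤ ((aeval (x i) : (C s)[X] →ₐ[C s] S).restrictScalars k).range := by
        refine Algebra.adjoin_le ?_
        have hmem (c : S) (hc : c ∈ C s) :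
            c ∈ ((aeval (x i) : (C s)[X] →ₐ[C s] S).restrictScalars k).range :=
          ⟨Polynomial.C ⟨c, hc⟩, by simp⟩
        rintro _ (⟨y, rfl⟩ | ⟨j, rfl | hj, rfl⟩)
        · exact hmem _ (hpow s y)
        · exact ⟨X, by simp⟩
        · exact hmem _ (Algebra.subset_adjoin (Or.inr ⟨j, hj, rfl⟩))
      obtain ⟨f, rfl⟩ := hle hc
      exact exists_sub_mem_of_derivation_mem (δ i) (hδC s i hi) (by simp [hδ]) (hJ _) p
        (hpow s _) f hzc (hz _)
  have htop : C Set.univ = ⊤ := by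
    simp only [C, Set.image_univ]
    refine adjoin_pow_eq_top p x ?_
    simpa only [← hx] using b.span_eq
  obtain ⟨c, hc, hzc⟩ := key Set.univ Set.finite_univ ⟨z, by simp [htop], by simp⟩
  have hle : C ∅ ≤ { (frobenius S p).range with
      algebraMap_mem' := fun r => by
        obtain ⟨r, rfl⟩ := surjective_frobenius k p r
        exact ⟨algebraMap k S r, by simp [frobenius_def]⟩ : Subalgebra k S } := by
    refine Algebra.adjoin_le ?_
    rintro _ (⟨y, rfl⟩ | ⟨j, hj, rfl⟩)
    · exact ⟨y, rfl⟩
    · exact hj.elim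
  obtain ⟨a, rfl⟩ := hle hc
  exact ⟨a, hzc⟩

end PolynomialDerivation

/-- The Frobenius power `m^{[p]}`. -/
abbrev Ideal.frobeniusPower {S : Type*} [CommRing S] (p : ℕ) (m : Ideal S) : Ideal S :=
  Ideal.span ((fun f : S => f ^ p) '' (m : Set S))

theorem derivation_mem_frobeniusPower {k S : Type*} [CommRing k] [CommRing S] [Algebra k S] (p : ℕ)
    [CharP S p] (m : Ideal S) (δ : Derivation k S S) {y : S} (hy : y ∈ m.frobeniusPower p) :
    δ y ∈ m.frobeniusPower p := by
  induction hy using Submodule.span_induction with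
  | mem y hy =>
    obtain ⟨f, -, rfl⟩ := hy
    simp [Derivation.leibniz_pow]
  | zero => simp
  | add y z _ _ hy hz => simpa using add_mem hy hz
  | smul a y hy' hy =>
    rw [smul_eq_mul, Derivation.leibniz]
    exact add_mem (Ideal.mul_mem_left _ _ hy) (Ideal.mul_mem_right _ _ hy')

theorem map_frobeniusPower {S T : Type*} [CommRing S] [CommRing T] (p : ℕ) [CharP T p]
    [Fact p.Prime] (φ : S →+* T) (m : Ideal S) :
    (m.frobeniusPower p).map φ = (m.map φ).frobeniusPower p := by
  apply le_antisymm
  · rw [Ideal.map_span, Ideal.span_le]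
    rintro _ ⟨_, ⟨f, hf, rfl⟩, rfl⟩
    exact Ideal.subset_span ⟨φ f, Ideal.mem_map_of_mem φ hf, by simp⟩
  · rw [Ideal.span_le]
    rintro _ ⟨f, hf, rfl⟩
    have h : m.map φ ≤ ((m.frobeniusPower p).map φ).comap (frobenius T p) := by
      rw [Ideal.map_le_iff_le_comap]
      intro g hg
      simpa [frobenius_def] using Ideal.mem_map_of_mem φ
        (Ideal.subset_span ⟨g, hg, rfl⟩ : g ^ p ∈ m.frobeniusPower p)
    exact h hf

open KaehlerDifferential in
theorem derivation_mem_of_D_mem_smul {k S : Type*} [CommRing k] [CommRing S] [Algebra k S]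
    {J : Ideal S} {z : S} (hz : D k S z ∈ J • (⊤ : Submodule S (Ω[S⁄k]))) (δ : Derivation k S S) :
    δ z ∈ J := by
  have := Submodule.mem_map_of_mem (f := δ.liftKaehlerDifferential) hz
  rw [Submodule.map_smul''] at this
  rw [Derivation.liftKaehlerDifferential_comp_D, smul_eq_mul] at this
  exact Ideal.mul_le_left this

open KaehlerDifferential in
theorem D_algebraMap_mem_smul {k S T : Type*} [CommRing k] [CommRing S] [Algebra k S]
    [CommRing T] [Algebra k T] [Algebra S T] [IsScalarTower k S T] {J : Ideal S} {z : S}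
    (hz : D k S z ∈ J • (⊤ : Submodule S (Ω[S⁄k]))) :
    D k T (algebraMap S T z) ∈ J.map (algebraMap S T) • (⊤ : Submodule T (Ω[T⁄k])) := by
  rw [← KaehlerDifferential.map_D k k S T]
  refine Submodule.smul_induction_on hz (fun r hr n _ => ?_) fun x y hx hy => ?_
  · rw [map_smul, ← algebraMap_smul T r]
    exact Submodule.smul_mem_smul (Ideal.mem_map_of_mem _ hr) trivial
  · simpa using add_mem hx hy

theorem exists_pow_mul_sub_pow_mem_of_localization {S : Type*} [CommRing S] (p : ℕ) [Fact p.Prime]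
    (f : S) (J : Ideal S) (z : S) (a : Localization.Away f)
    (h : algebraMap S _ z - a ^ p ∈ J.map (algebraMap S (Localization.Away f))) :
    ∃ (n : ℕ) (c : S), (f ^ n) ^ p * z - c ^ p ∈ J := by
  have hp : 1 ≤ p := (Fact.out : p.Prime).one_le
  obtain ⟨n, c, hc⟩ := IsLocalization.Away.surj f a
  have h1 : algebraMap S (Localization.Away f) ((f ^ n) ^ p * z - c ^ p) ∈
      J.map (algebraMap S (Localization.Away f)) := by
    have := Ideal.mul_mem_left _ (algebraMap S (Localization.Away f) f ^ (n * p)) h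
    rw [mul_sub, pow_mul, ← mul_pow, mul_comm _ a, hc] at this
    simpa using this
  obtain ⟨_, ⟨l, rfl⟩, hl⟩ := (IsLocalization.algebraMap_mem_map_algebraMap_iff (.powers f)
    (Localization.Away f) J _).mp h1
  refine ⟨l + n, f ^ l * c, ?_⟩
  have h2 := J.mul_mem_left ((f ^ l) ^ (p - 1)) hl
  have h3 : (f ^ l) ^ (p - 1) * f ^ l = (f ^ l) ^ p := pow_sub_one_mul (by omega) _
  rw [← mul_assoc, h3] at h2
  rw [pow_add, mul_pow, mul_pow, mul_assoc, ← mul_sub]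
  exact h2

open KaehlerDifferential in
theorem exists_sub_pow_mem_frobeniusPower {k S : Type u} [Field k] [CommRing S] [Algebra k S]
    [Algebra.FiniteType k S] [Algebra.FormallySmooth k S] (p : ℕ) [Fact p.Prime] [CharP k p]
    [PerfectRing k p] (m : Ideal S) (x : S)
    (hx : D k S x ∈ m.frobeniusPower p • (⊤ : Submodule S (Ω[S⁄k]))) :
    ∃ a : S, x - a ^ p ∈ m.frobeniusPower p := by
  nontriviality S
  have : CharP S p := charP_of_injective_algebraMap (algebraMap k S).injective p
  have : Algebra.FinitePresentation k S := Algebra.FinitePresentation.of_finiteType.mp ‹_›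
  have : Algebra.Smooth k S := ⟨inferInstance, inferInstance⟩
  have hp : p ≠ 0 := (Fact.out : p.Prime).ne_zero
  let I : Ideal S :=
    { carrier := {c | ∃ a : S, c ^ p * x - a ^ p ∈ m.frobeniusPower p}
      zero_mem' := ⟨0, by simp [hp]⟩
      add_mem' := by
        rintro c d ⟨a, ha⟩ ⟨b, hb⟩
        refine ⟨a + b, ?_⟩
        rw [add_pow_char, add_pow_char]
        convert add_mem ha hb using 1
        ring
      smul_mem' := by
        rintro c d ⟨a, ha⟩
        refine ⟨c * a, ?_⟩
        convert Ideal.mul_mem_left _ (c ^ p) ha using 1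
        rw [smul_eq_mul]
        ring }
  suffices h : I = ⊤ by
    obtain ⟨a, ha⟩ : (1 : S) ∈ I := h ▸ Submodule.mem_top
    exact ⟨a, by simpa using ha⟩
  by_contra hI
  obtain ⟨n, hn, hIn⟩ := Ideal.exists_le_maximal I hI
  have hsm : Algebra.IsSmoothAt k n := by
    have : (⟨n, hn.isPrime⟩ : PrimeSpectrum S) ∈ Algebra.smoothLocus k S := by
      rw [Algebra.smoothLocus_eq_univ]; trivial
    exact this
  obtain ⟨f, hfn, hf⟩ := Algebra.IsSmoothAt.exists_notMem_isStandardSmooth (R := k) n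
  obtain ⟨-, ι, b, hb⟩ :=
    Algebra.IsStandardSmooth.iff_exists_basis_kaehlerDifferential.mp hf
  choose y hy using fun i => hb ⟨i, rfl⟩
  have hnt : Nontrivial (Localization.Away f) := by
    by_contra h
    rw [not_nontrivial_iff_subsingleton] at h
    obtain ⟨l, hl⟩ := (IsLocalization.subsingleton_iff (M := .powers f)).mp h
    exact hfn (hn.isPrime.mem_of_pow_mem l (by simp [hl]))
  have : CharP (Localization.Away f) p :=
    charP_of_injective_algebraMap (algebraMap k _).injective p
  obtain ⟨a, ha⟩ := exists_sub_pow_mem_of_basis p b y (fun i => (hy i).symm)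
    ((m.frobeniusPower p).map (algebraMap S (Localization.Away f)))
    (fun δ y hy => by
      rw [map_frobeniusPower] at hy ⊢
      exact derivation_mem_frobeniusPower p _ δ hy)
    (algebraMap S _ x) (derivation_mem_of_D_mem_smul (D_algebraMap_mem_smul hx))
  obtain ⟨l, c, hc⟩ := exists_pow_mul_sub_pow_mem_of_localization p f _ x a ha
  exact hfn (hn.isPrime.mem_of_pow_mem l (hIn ⟨c, hc⟩))

theorem stmt_11 (p : ℕ) [Fact p.Prime] (hp : 2 < p)
    (k : Type u) [Field k] [CharP k p] [ExpChar k p] [PerfectRing k p]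
    (S : Type u) [CommRing S] [Algebra k S]
    (hfg : Algebra.FiniteType k S) [Algebra.FormallySmooth k S]
    (m : Ideal S) (x : S)
    (hx : KaehlerDifferential.D k S x ∈
      (Ideal.span ((fun f : S => f ^ p) '' (m : Set S))) •
        (⊤ : Submodule S (KaehlerDifferential k S))) :
    ∃ a b : S, b ∈ Ideal.span ((fun f : S => f ^ p) '' (m : Set S)) ∧ x = a ^ p + b := by
  obtain ⟨a, ha⟩ := exists_sub_pow_mem_frobeniusPower (k := k) p m x hx
  exact ⟨a, x - a ^ p, ha, by ring⟩
end

section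
/- Let m be an ideal of S. Then m^{[p]}·Ω¹_{S/k} ∩ d(S) = d(m^{[p]}): an exact Kähler 1-form ω = d x (x ∈ S) lies in the submodule m^{[p]}·Ω¹_{S/k} if and only if ω = d y for some y ∈ m^{[p]}. -/
/-- The ideal generated by the `p`-th powers of the elements of `m`. -/
abbrev Ideal.pthPowers {R : Type*} [CommRing R] (p : ℕ) (m : Ideal R) : Ideal R :=
  Ideal.span ((fun f : R => f ^ p) '' (m : Set R))

section Derivation

variable {k R : Type*} [Field k] [CommRing R] [Algebra k R]

namespace Derivation

theorem iterate_mul_s12 (D : Derivation k R R) (n : ℕ) (a b : R) :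
    D^[n] (a * b) = ∑ ij ∈ Finset.HasAntidiagonal.antidiagonal n,
      n.choose ij.1 • (D^[ij.1] a * D^[ij.2] b) := by
  induction n with
  | zero => simp
  | succ n ih =>
    rw [Finset.sum_antidiagonal_choose_succ_nsmul (fun i j => D^[i] a * D^[j] b) n,
      Function.iterate_succ_apply', ih, map_sum, ← Finset.sum_add_distrib]
    refine Finset.sum_congr rfl fun ij hij => ?_
    rw [← Nat.choose_symm_of_eq_add (Finset.HasAntidiagonal.mem_antidiagonal.mp hij).symm]
    simp only [map_nsmul, Derivation.leibniz, smul_eq_mul, Function.iterate_succ_apply', smul_add]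
    congr 2
    ring

/-- In characteristic `p`, the `p`-th iterate of a derivation is a derivation. -/
def iterateChar_s12 (p : ℕ) [Fact p.Prime] [CharP R p] (D : Derivation k R R) :
    Derivation k R R :=
  Derivation.mk' ((D : R →ₗ[k] R) ^ p) fun a b => by
    have hp : p.Prime := Fact.out
    simp only [Module.End.pow_apply, Derivation.coeFn_coe]
    rw [iterate_mul_s12, Finset.Nat.sum_antidiagonal_eq_sum_range_succ_mk, Finset.sum_range_succ,
      Finset.sum_range_eq_add_Ico _ hp.pos, Finset.sum_eq_zero]
    · simp [mul_comm]
    · intro i hi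
      rw [Finset.mem_Ico] at hi
      rw [nsmul_eq_mul, (CharP.cast_eq_zero_iff R p _).mpr
        (hp.dvd_choose_self (by omega) hi.2), zero_mul]

theorem iterateChar_apply_s12 (p : ℕ) [Fact p.Prime] [CharP R p] (D : Derivation k R R) (a : R) :
    D.iterateChar_s12 p a = D^[p] a := by
  simp [iterateChar_s12, Module.End.pow_apply]

theorem map_pow_char_s12 (p : ℕ) [CharP R p] (D : Derivation k R R) (f : R) : D (f ^ p) = 0 := by
  rw [Derivation.leibniz_pow, ← Nat.cast_smul_eq_nsmul R, CharP.cast_eq_zero, zero_smul]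

theorem mem_pthPowers (p : ℕ) [CharP R p] (D : Derivation k R R) {m : Ideal R} {y : R}
    (hy : y ∈ m.pthPowers p) : D y ∈ m.pthPowers p := by
  induction hy using Submodule.span_induction with
  | mem x hx =>
    obtain ⟨f, -, rfl⟩ := hx
    simp
  | zero => simp
  | add x y _ _ hx hy => simpa using add_mem hx hy
  | smul a x hx hx' =>
    rw [smul_eq_mul, Derivation.leibniz]
    refine add_mem (Ideal.mul_mem_left _ _ hx') ?_
    rw [smul_eq_mul]
    exact Ideal.mul_mem_right _ _ hx

/-- If `D ^ p = 0` and `D x = 1`, this is a primitive of `D g` with respect to `D`. -/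
def primitive (p : ℕ) (D : Derivation k R R) (x g : R) : R :=
  ∑ j ∈ Finset.range (p - 1),
    ((-1) ^ j * ((j + 1).factorial : k)⁻¹) • (x ^ (j + 1) * D^[j + 1] g)

theorem apply_primitive (p : ℕ) [Fact p.Prime] [CharP k p] (D : Derivation k R R) {x g : R}
    (hx : D x = 1) (hg : D^[p] g = 0) : D (primitive p D x g) = D g := by
  have hp : p.Prime := Fact.out
  let t : ℕ → R := fun j => ((-1) ^ j * ((j.factorial : k))⁻¹) • (x ^ j * D^[j + 1] g)
  have key : D (primitive p D x g) = ∑ j ∈ Finset.range (p - 1), (t j - t (j + 1)) := by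
    rw [primitive, map_sum]
    refine Finset.sum_congr rfl fun j hj => ?_
    have hj' : j + 1 < p := by have := Finset.mem_range.mp hj; omega
    have hne : ((j + 1 : ℕ) : k) ≠ 0 := by
      rw [Ne, CharP.cast_eq_zero_iff k p]
      exact Nat.not_dvd_of_pos_of_lt (by omega) hj'
    have hfac : ((j + 1).factorial : k)⁻¹ * ((j + 1 : ℕ) : k) = (j.factorial : k)⁻¹ := by
      rw [Nat.factorial_succ, Nat.cast_mul, mul_inv, mul_comm, ← mul_assoc, mul_inv_cancel₀ hne,
        one_mul]
    have h1 : D (x ^ (j + 1)) = ((j + 1 : ℕ) : k) • x ^ j := by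
      rw [Derivation.leibniz_pow, hx, Nat.cast_smul_eq_nsmul]
      simp
    simp only [t]
    rw [map_smul, Derivation.leibniz, h1, ← hfac, pow_succ (-1 : k)]
    simp only [smul_eq_mul, ← Function.iterate_succ_apply' D, Algebra.smul_def, map_mul, map_neg,
      map_one, map_pow]
    ring
  rw [key, Finset.sum_range_sub']
  have h0 : t (p - 1) = 0 := by
    simp only [t]
    rw [Nat.sub_add_cancel hp.one_le, hg, mul_zero, smul_zero]
  rw [h0]
  simp [t]

theorem apply_primitive_of_commute (p : ℕ) (D E : Derivation k R R) {x g : R}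
    (hx : E x = 0) (hc : ∀ a, E (D a) = D (E a)) (hg : E g = 0) :
    E (primitive p D x g) = 0 := by
  have hit : ∀ n, E (D^[n] g) = 0 := by
    intro n
    induction n with
    | zero => simpa
    | succ n ih => rw [Function.iterate_succ_apply', hc, ih, map_zero]
  rw [primitive, map_sum]
  refine Finset.sum_eq_zero fun j _ => ?_
  rw [map_smul, Derivation.leibniz, hit, Derivation.leibniz_pow, hx]
  simp

theorem primitive_mem (p : ℕ) [CharP R p] (D : Derivation k R R) {x g : R} {m : Ideal R}
    (hg : D g ∈ m.pthPowers p) : primitive p D x g ∈ m.pthPowers p := by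
  have hit : ∀ n, D^[n + 1] g ∈ m.pthPowers p := by
    intro n
    induction n with
    | zero => simpa
    | succ n ih => rw [Function.iterate_succ_apply']; exact mem_pthPowers p D ih
  refine sum_mem fun j _ => ?_
  rw [Algebra.smul_def]
  exact Ideal.mul_mem_left _ _ (Ideal.mul_mem_left _ _ (hit j))

/-- For commuting derivations `D i` dual to coordinates `x i` and with vanishing `p`-th powers,
the system `D i y = D i g` has a solution in the ideal `m.pthPowers p` as soon as this ideal
contains all the right-hand sides. -/
theorem exists_mem_pthPowers_forall_apply_eq (p : ℕ) [Fact p.Prime] [CharP k p] [CharP R p]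
    {ι : Type*} [Finite ι] (D : ι → Derivation k R R) (x : ι → R) (hx : ∀ i, D i (x i) = 1)
    (hx' : ∀ i j, i ≠ j → D i (x j) = 0) (hc : ∀ i j a, D i (D j a) = D j (D i a))
    (hD : ∀ i a, (D i)^[p] a = 0) (m : Ideal R) (g : R) (hg : ∀ i, D i g ∈ m.pthPowers p) :
    ∃ y ∈ m.pthPowers p, ∀ i, D i y = D i g := by
  classical
  cases nonempty_fintype ι
  suffices h : ∀ s : Finset ι, ∃ y ∈ m.pthPowers p, ∀ i ∈ s, D i (g - y) = 0 by
    obtain ⟨y, hy, h⟩ := h Finset.univ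
    refine ⟨y, hy, fun i => ?_⟩
    have := h i (Finset.mem_univ i)
    rw [map_sub, sub_eq_zero] at this
    exact this.symm
  intro s
  induction s using Finset.induction_on with
  | empty => exact ⟨0, zero_mem _, by simp⟩
  | insert a s ha ih =>
    obtain ⟨y, hy, h⟩ := ih
    have hmem : D a (g - y) ∈ m.pthPowers p := by
      rw [map_sub]
      exact sub_mem (hg a) (mem_pthPowers p _ hy)
    refine ⟨y + primitive p (D a) (x a) (g - y), add_mem hy (primitive_mem p _ hmem), ?_⟩
    intro i hi
    rw [← sub_sub, map_sub, sub_eq_zero]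
    rcases Finset.mem_insert.mp hi with rfl | hi
    · exact (apply_primitive p _ (hx i) (hD i _)).symm
    · have hia : i ≠ a := fun e => ha (e ▸ hi)
      rw [h i hi, apply_primitive_of_commute p _ _ (hx' i a hia) (hc i a) (h i hi)]

end Derivation

namespace KaehlerDifferential

/-- The derivation `∂/∂xᵢ` attached to a basis of the module of differentials. -/
noncomputable def coordDerivation {ι : Type*} (b : Module.Basis ι R (KaehlerDifferential k R)) (i : ι) :
    Derivation k R R :=
  (b.coord i).compDer (D k R)

theorem coordDerivation_apply {ι : Type*} (b : Module.Basis ι R (KaehlerDifferential k R))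
    (i : ι) (g : R) : coordDerivation b i g = b.repr (D k R g) i := rfl

theorem derivation_eq_zero_of_basis {ι : Type*} (b : Module.Basis ι R (KaehlerDifferential k R))
    {x : ι → R} (hb : ∀ i, b i = D k R (x i)) (E : Derivation k R R) (hE : ∀ i, E (x i) = 0) :
    E = 0 := by
  have h : E.liftKaehlerDifferential = 0 := b.ext fun i => by simp [hb, hE]
  rw [← E.liftKaehlerDifferential_comp, h]
  ext
  simp

section Coordinates

variable {ι : Type*} (b : Module.Basis ι R (KaehlerDifferential k R)) {x : ι → R}

theorem coordDerivation_coord (hb : ∀ i, b i = D k R (x i))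
    [DecidableEq ι] (i j : ι) :
    coordDerivation b i (x j) = if j = i then 1 else 0 := by
  rw [coordDerivation_apply, ← hb, Module.Basis.repr_self, Finsupp.single_apply]

theorem coordDerivation_coordDerivation_coord (hb : ∀ i, b i = D k R (x i))
    (i j l : ι) :
    coordDerivation b i (coordDerivation b j (x l)) = 0 := by
  classical
  rw [coordDerivation_coord b hb]
  split_ifs
  · exact Derivation.map_one_eq_zero _
  · exact map_zero _

theorem coordDerivation_comm (hb : ∀ i, b i = D k R (x i))
    (i j : ι) (a : R) :
    coordDerivation b i (coordDerivation b j a) = coordDerivation b j (coordDerivation b i a) := by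
  have h : ⁅coordDerivation b i, coordDerivation b j⁆ = 0 := by
    refine derivation_eq_zero_of_basis b hb _ fun l => ?_
    rw [Derivation.commutator_apply, coordDerivation_coordDerivation_coord b hb,
      coordDerivation_coordDerivation_coord b hb, sub_zero]
  rw [← sub_eq_zero, ← Derivation.commutator_apply, h, Derivation.zero_apply]

theorem coordDerivation_iterate_char (hb : ∀ i, b i = D k R (x i))
    (p : ℕ) [Fact p.Prime] [CharP R p] (i : ι) (a : R) :
    (coordDerivation b i)^[p] a = 0 := by
  have hp : p.Prime := Fact.out
  have h : (coordDerivation b i).iterateChar_s12 p = 0 := by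
    refine derivation_eq_zero_of_basis b hb _ fun l => ?_
    rw [Derivation.iterateChar_apply_s12, ← Nat.sub_add_cancel hp.two_le,
      Function.iterate_add_apply, Function.iterate_succ_apply, Function.iterate_one,
      coordDerivation_coordDerivation_coord b hb]
    exact iterate_map_zero _ _
  rw [← Derivation.iterateChar_apply_s12, h, Derivation.zero_apply]

theorem coordDerivation_mem {I : Ideal R} {g : R}
    (hg : D k R g ∈ I • (⊤ : Submodule R (KaehlerDifferential k R))) (i : ι) :
    coordDerivation b i g ∈ I := by
  rw [coordDerivation_apply, ← Module.Basis.coord_apply]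
  refine Submodule.smul_induction_on hg (fun r hr n _ => ?_) (fun _ _ h h' => ?_)
  · rw [map_smul]
    exact Ideal.mul_mem_right _ _ hr
  · rw [map_add]
    exact add_mem h h'

theorem exists_mem_pthPowers_of_basis (hb : ∀ i, b i = D k R (x i))
    (p : ℕ) [Fact p.Prime] [CharP k p] [CharP R p]
    [Finite ι] (m : Ideal R) (g : R)
    (hg : D k R g ∈ m.pthPowers p • (⊤ : Submodule R (KaehlerDifferential k R))) :
    ∃ y ∈ m.pthPowers p, D k R y = D k R g := by
  classical
  obtain ⟨y, hy, h⟩ := Derivation.exists_mem_pthPowers_forall_apply_eq p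
    (coordDerivation b) x (fun i => by simp [coordDerivation_coord b hb])
    (fun i j hij => by simp [coordDerivation_coord b hb, hij.symm])
    (coordDerivation_comm b hb) (coordDerivation_iterate_char b hb p) m g
    (coordDerivation_mem b hg)
  exact ⟨y, hy, b.repr.injective (Finsupp.ext h)⟩

end Coordinates

end KaehlerDifferential

end Derivation

namespace KaehlerDifferential

theorem exists_mem_pthPowers_of_isLocalRing (p : ℕ) [Fact p.Prime] {k R : Type*} [Field k]
    [CommRing R] [Algebra k R] [CharP k p] [CharP R p] [IsLocalRing R]
    [Algebra.EssFiniteType k R] [Algebra.FormallySmooth k R] (m : Ideal R) (g : R)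
    (hg : D k R g ∈ m.pthPowers p • (⊤ : Submodule R (KaehlerDifferential k R))) :
    ∃ y ∈ m.pthPowers p, D k R y = D k R g := by
  obtain ⟨ι, a, b, hb⟩ := Module.exists_basis_of_span_of_flat (R := R) (fun x : R => D k R x)
    (span_range_derivation k R)
  have : Finite ι := Module.Finite.finite_basis b
  exact exists_mem_pthPowers_of_basis b hb p m g hg

theorem D_pow_mul (p : ℕ) {k R : Type*} [Field k] [CommRing R] [Algebra k R] [CharP R p]
    (s x : R) : D k R (s ^ p * x) = s ^ p • D k R x := by
  rw [Derivation.leibniz, Derivation.leibniz_pow, ← Nat.cast_smul_eq_nsmul R p,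
    CharP.cast_eq_zero, zero_smul, smul_zero, add_zero]

end KaehlerDifferential

theorem Ideal.pthPowers_map {R T : Type*} [CommRing R] [CommRing T] (p : ℕ) [Fact p.Prime]
    [CharP T p] (f : R →+* T) (m : Ideal R) :
    (m.pthPowers p).map f = (m.map f).pthPowers p := by
  apply le_antisymm
  · rw [Ideal.map_span, Ideal.span_le]
    rintro _ ⟨_, ⟨a, ha, rfl⟩, rfl⟩
    exact Ideal.subset_span ⟨f a, Ideal.mem_map_of_mem f ha, by simp⟩
  · rw [Ideal.span_le]
    rintro _ ⟨a, ha, rfl⟩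
    have h : m.map f ≤ ((m.pthPowers p).map f).comap (frobenius T p) := by
      rw [Ideal.map_le_iff_le_comap]
      intro c hc
      simp only [Ideal.mem_comap, frobenius_def, ← map_pow]
      exact Ideal.mem_map_of_mem f (Ideal.subset_span ⟨c, hc, rfl⟩)
    exact h ha

namespace KaehlerDifferential

theorem exists_pow_mul_mem_pthPowers (p : ℕ) [Fact p.Prime] {k S : Type*} [Field k]
    [CommRing S] [Algebra k S] [CharP k p] [CharP S p]
    [Algebra.FiniteType k S] [Algebra.FormallySmooth k S] (m : Ideal S) (x : S)
    (hx : D k S x ∈ m.pthPowers p • (⊤ : Submodule S (KaehlerDifferential k S)))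
    (q : Ideal S) [q.IsPrime] :
    ∃ s ∉ q, ∃ z ∈ m.pthPowers p, D k S z = s ^ p • D k S x := by
  have hp : p.Prime := Fact.out
  let R := Localization.AtPrime q
  have : CharP R p := charP_of_injective_algebraMap (algebraMap k R).injective p
  have : Algebra.FormallySmooth S R := Algebra.FormallySmooth.of_isLocalization q.primeCompl
  have : Algebra.FormallySmooth k R := Algebra.FormallySmooth.comp k S R
  have : Algebra.EssFiniteType S R := Algebra.EssFiniteType.of_isLocalization R q.primeCompl
  have : Algebra.EssFiniteType k R := Algebra.EssFiniteType.comp k S R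
  have hR : D k R (algebraMap S R x) ∈ (m.map (algebraMap S R)).pthPowers p •
      (⊤ : Submodule R (KaehlerDifferential k R)) := by
    rw [← Ideal.pthPowers_map, ← map_D k k S R]
    refine Submodule.smul_induction_on hx (fun r hr n _ => ?_) (fun _ _ h h' => ?_)
    · rw [map_smul, ← algebraMap_smul R r]
      exact Submodule.smul_mem_smul (Ideal.mem_map_of_mem _ hr) trivial
    · rw [map_add]
      exact add_mem h h'
  obtain ⟨y, hy, hyx⟩ := exists_mem_pthPowers_of_isLocalRing p _ _ hR
  rw [← Ideal.pthPowers_map, IsLocalization.mem_map_algebraMap_iff q.primeCompl] at hy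
  obtain ⟨⟨⟨z, hz⟩, s⟩, hzs⟩ := hy
  simp only at hzs
  have hz' : s.1 ^ (p - 1) * z ∈ m.pthPowers p := Ideal.mul_mem_left _ _ hz
  have hmap : map k k S R (D k S (s.1 ^ p * x - s.1 ^ (p - 1) * z)) = 0 := by
    have : s.1 ^ p = s.1 ^ (p - 1) * s.1 := by rw [← pow_succ, Nat.sub_add_cancel hp.one_le]
    have e : algebraMap S R (s.1 ^ (p - 1) * z) = (algebraMap S R s.1) ^ p * y := by
      rw [map_mul, ← hzs, ← map_pow, this, map_mul]
      ring
    rw [map_D, map_sub, e, map_mul, map_pow, map_sub, D_pow_mul, D_pow_mul, hyx, sub_self]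
  obtain ⟨t, ht⟩ := (IsLocalizedModule.eq_zero_iff q.primeCompl (map k k S R)).mp hmap
  refine ⟨t * s, (t * s).2, t.1 ^ p * (s.1 ^ (p - 1) * z), Ideal.mul_mem_left _ _ hz', ?_⟩
  rw [Submonoid.smul_def, map_sub, D_pow_mul, smul_sub, sub_eq_zero] at ht
  have htp : t.1 ^ p = t.1 ^ (p - 1) * t.1 := by rw [← pow_succ, Nat.sub_add_cancel hp.one_le]
  rw [D_pow_mul, htp, mul_smul, ← ht, mul_pow, htp, mul_smul, mul_smul]

theorem exists_mem_pthPowers (p : ℕ) [Fact p.Prime] {k S : Type*} [Field k]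
    [CommRing S] [Algebra k S] [CharP k p] [CharP S p]
    [Algebra.FiniteType k S] [Algebra.FormallySmooth k S] (m : Ideal S) (x : S)
    (hx : D k S x ∈ m.pthPowers p • (⊤ : Submodule S (KaehlerDifferential k S))) :
    ∃ y ∈ m.pthPowers p, D k S y = D k S x := by
  let J : Ideal S :=
    { carrier := {s | ∃ z ∈ m.pthPowers p, D k S z = s ^ p • D k S x}
      add_mem' := by
        rintro a b ⟨z, hz, h⟩ ⟨w, hw, h'⟩
        exact ⟨z + w, add_mem hz hw, by rw [map_add, h, h', add_pow_char, add_smul]⟩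
      zero_mem' := ⟨0, zero_mem _, by simp [(Fact.out : p.Prime).ne_zero]⟩
      smul_mem' := by
        rintro a b ⟨z, hz, h⟩
        exact ⟨a ^ p * z, Ideal.mul_mem_left _ _ hz, by
          rw [D_pow_mul, h, smul_eq_mul, mul_pow, mul_smul]⟩ }
  have hJ : J = ⊤ := by
    by_contra hne
    obtain ⟨q, hq, hle⟩ := Ideal.exists_le_maximal J hne
    have := hq.isPrime
    obtain ⟨s, hs, h⟩ := exists_pow_mul_mem_pthPowers p m x hx q
    exact hs (hle h)
  obtain ⟨z, hz, h⟩ : (1 : S) ∈ J := hJ ▸ trivial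
  exact ⟨z, hz, by simpa using h⟩

theorem D_mem_pthPowers_smul_top (p : ℕ) {k S : Type*} [Field k] [CommRing S] [Algebra k S]
    [CharP S p] {m : Ideal S} {y : S} (hy : y ∈ m.pthPowers p) :
    D k S y ∈ m.pthPowers p • (⊤ : Submodule S (KaehlerDifferential k S)) := by
  induction hy using Submodule.span_induction with
  | mem x hx =>
    obtain ⟨f, -, rfl⟩ := hx
    have := D_pow_mul p (k := k) f 1
    simp_all
  | zero => simp
  | add x y _ _ hx hy => simpa using add_mem hx hy
  | smul a x hx hx' =>
    rw [smul_eq_mul, Derivation.leibniz]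
    exact add_mem (Submodule.smul_mem _ _ hx') (Submodule.smul_mem_smul hx trivial)

end KaehlerDifferential

/-- Let `k` be a perfect field of characteristic `p > 2` and `S` a smooth affine
`k`-algebra. For an ideal `m` of `S`, an exact Kähler 1-form `ω = d x` lies in
`m^{[p]}·Ω¹_{S/k}` if and only if `ω = d y` for some `y ∈ m^{[p]}`;
that is, `m^{[p]}·Ω¹_{S/k} ∩ d(S) = d(m^{[p]})`. -/
theorem stmt_12 (p : ℕ) [Fact p.Prime] (hp : 2 < p)
    (k : Type u) [Field k] [CharP k p] [ExpChar k p] [PerfectRing k p]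
    (S : Type u) [CommRing S] [Algebra k S]
    (hfg : Algebra.FiniteType k S) [Algebra.FormallySmooth k S]
    (m : Ideal S) (ω : KaehlerDifferential k S) :
    (ω ∈ (Ideal.span ((fun f : S => f ^ p) '' (m : Set S))) •
        (⊤ : Submodule S (KaehlerDifferential k S)) ∧ ∃ x : S, KaehlerDifferential.D k S x = ω)
      ↔ ∃ y ∈ Ideal.span ((fun f : S => f ^ p) '' (m : Set S)),
          KaehlerDifferential.D k S y = ω := by
  cases subsingleton_or_nontrivial S with
  | inl h =>
    have := Module.subsingleton S (KaehlerDifferential k S)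
    exact ⟨fun _ => ⟨0, zero_mem _, Subsingleton.elim _ _⟩,
      fun _ => ⟨by rw [Subsingleton.elim ω 0]; exact zero_mem _, 0, Subsingleton.elim _ _⟩⟩
  | inr h =>
    have : CharP S p := charP_of_injective_algebraMap (algebraMap k S).injective p
    constructor
    · rintro ⟨hω, x, rfl⟩
      exact KaehlerDifferential.exists_mem_pthPowers p m x hω
    · rintro ⟨y, hy, rfl⟩
      exact ⟨KaehlerDifferential.D_mem_pthPowers_smul_top p hy, y, rfl⟩
end

section
/- Let k be an algebraically closed field of characteristic p > 0 and let S be a finitely generated commutative k-algebra that is an integral domain. Then ⋂_{n≥1} S^{p^n} = k·1, where S^{p^n} = { s^{p^n} : s ∈ S }; that is, an element of S which is a p^n-th power for every n ≥ 1 is a scalar. -/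
/-- If `k` is an algebraically closed field of characteristic `p > 0` and `S` is a
finitely generated commutative `k`-algebra which is an integral domain, then an element of `S`
which is a `p^n`-th power for every `n ≥ 1` lies in `k·1`. -/
theorem stmt_14 (p : ℕ) (hp : 0 < p)
    (k : Type*) [Field k] [IsAlgClosed k] [CharP k p]
    (S : Type*) [CommRing S] [IsDomain S] [Algebra k S]
    (hfg : Algebra.FiniteType k S) :
    {s : S | ∀ n : ℕ, 1 ≤ n → ∃ t : S, s = t ^ p ^ n} = Set.range (algebraMap k S) := by
  have hprime : p.Prime := (CharP.char_is_prime_or_zero k p).resolve_right hp.ne'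
  have : Fact p.Prime := ⟨hprime⟩
  have : CharP S p := charP_of_injective_algebraMap (algebraMap k S).injective p
  have : IsNoetherianRing S := Algebra.FiniteType.isNoetherianRing k S
  ext s
  constructor
  · intro hs
    obtain ⟨m, hm⟩ := Ideal.exists_maximal S
    let _ : Field (S ⧸ m) := Ideal.Quotient.field m
    have : Module.Finite k (S ⧸ m) := finite_of_finite_type_of_isJacobsonRing k (S ⧸ m)
    obtain ⟨c, hc⟩ := (IsAlgClosed.algebraMap_bijective_of_isIntegral (k := k)).2
      (Ideal.Quotient.mk m s)
    have hcm : s - algebraMap k S c ∈ m := by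
      rw [← Ideal.Quotient.eq, ← hc]
      rfl
    refine ⟨c, (sub_eq_zero.mp ?_).symm⟩
    rw [← Ideal.mem_bot, ← Ideal.iInf_pow_eq_bot_of_isDomain m hm.ne_top, Ideal.mem_iInf]
    intro n
    obtain ⟨t, ht⟩ := hs (n + 1) (by omega)
    obtain ⟨d, hd⟩ := IsAlgClosed.exists_pow_nat_eq c (pow_pos hp (n + 1))
    have heq : s - algebraMap k S c = (t - algebraMap k S d) ^ p ^ (n + 1) := by
      rw [sub_pow_char_pow, ← map_pow, hd, ← ht]
    rw [heq] at hcm ⊢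
    have hle : n ≤ p ^ (n + 1) :=
      (Nat.le_succ n).trans (Nat.lt_pow_self hprime.one_lt).le
    exact Ideal.pow_le_pow_right hle (Ideal.pow_mem_pow (hm.isPrime.mem_of_pow_mem _ hcm) _)
  · rintro ⟨c, rfl⟩ n -
    obtain ⟨d, hd⟩ := IsAlgClosed.exists_pow_nat_eq c (pow_pos hp n)
    exact ⟨algebraMap k S d, by rw [← map_pow, hd]⟩
end
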